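/- arXiv:1806.06022 — 9 statements merged into one kernel-verified Lean document; each statement's English description precedes it below -/
import Mathlib

section
/- For all positive integers k and m there is a constant C = C(k, m) such that the following holds. If G is a group and A ⊆ G is a nonempty finite set with |A³| ≤ k|A| and ⟨A⟩ = Āᵐ, where Ā = A ∪ A⁻¹ ∪ {1}, then there are a normal subgroup H of ⟨A⟩ with [⟨A⟩ : H] ≤ C, and a (δ, n)-Bohr neighborhood B in H with δ⁻¹ ≤ C and n ≤ C, such that B ⊆ (AA⁻¹)² ∩ A²A⁻² ∩ (A⁻¹A)² ∩ A⁻²A². Moreover, if ⟨A⟩ is abelian, then one may take H = ⟨A⟩. -/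
open Pointwise

/-- The `n`-dimensional torus `(ℝ/ℤ)ⁿ`. -/
abbrev Torus (n : ℕ) : Type := Fin n → AddCircle (1 : ℝ)

/-- `B` is a `(δ, n)`-Bohr neighborhood in the group `H`: there is a homomorphism
`τ : H → 𝕋ⁿ` with `B = {x ∈ H : d(0, τ(x)) < δ}`. -/
def IsBohrNbhd {H : Type*} [Group H] (δ : ℝ) (n : ℕ) (B : Set H) : Prop :=
  ∃ τ : H →* Multiplicative (Torus n),
    B = {x : H | dist (0 : Torus n) (Multiplicative.toAdd (τ x)) < δ}



lemma aux_comm_norm {R : Type*} [NormedRing R] (x y : Rˣ)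
    (hx : ‖((x⁻¹ : Rˣ) : R)‖ ≤ 1) (hy : ‖((y⁻¹ : Rˣ) : R)‖ ≤ 1) :
    ‖((x * y * x⁻¹ * y⁻¹ : Rˣ) : R) - 1‖ ≤ 2 * ‖(x : R) - 1‖ * ‖(y : R) - 1‖ := by
  have h : ((x * y * x⁻¹ * y⁻¹ : Rˣ) : R) - 1
      = (((x : R) - 1) * ((y : R) - 1) - ((y : R) - 1) * ((x : R) - 1))
        * (((x⁻¹ : Rˣ) : R) * ((y⁻¹ : Rˣ) : R)) := by
    have e : (1 : R) = ((y : R) * (x : R)) * (((x⁻¹ : Rˣ) : R) * ((y⁻¹ : Rˣ) : R)) := by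
      simp [mul_assoc]
    conv_lhs => rw [e]
    push_cast
    noncomm_ring
  rw [h]
  have h1 := norm_mul_le ((x : R) - 1) ((y : R) - 1)
  have h2 := norm_mul_le ((y : R) - 1) ((x : R) - 1)
  calc _ ≤ ‖((x : R) - 1) * ((y : R) - 1) - ((y : R) - 1) * ((x : R) - 1)‖
        * ‖(((x⁻¹ : Rˣ) : R) * ((y⁻¹ : Rˣ) : R))‖ := norm_mul_le _ _
    _ ≤ (2 * ‖(x : R) - 1‖ * ‖(y : R) - 1‖) * 1 := by
        gcongr
        · refine (norm_sub_le _ _).trans ?_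
          nlinarith
        · refine (norm_mul_le _ _).trans ?_
          exact mul_le_one₀ hx (norm_nonneg _) hy
    _ = _ := by ring

lemma aux_pow_one {R : Type*} [NormedRing R] [NormedAlgebra ℂ R] (c : R)
    (h : ∀ n : ℕ, ‖c ^ n - 1‖ ≤ 1 / 2) : c = 1 := by
  have key : ∀ j : ℕ, (3 / 2 : ℝ) ^ j * ‖c - 1‖ ≤ ‖c ^ (2 ^ j) - 1‖ := by
    intro j
    induction j with
    | zero => simp
    | succ j ih =>
      set z := c ^ (2 ^ j) - 1 with hz
      have e : c ^ (2 ^ (j + 1)) - 1 = 2 • z + z * z := by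
        have : c ^ (2 ^ j) = z + 1 := by simp [hz]
        rw [pow_succ 2 j, pow_mul, this]
        noncomm_ring
      have e2 : 2 • z = (c ^ (2 ^ (j + 1)) - 1) - z * z := by rw [e]; abel
      have h3 : 2 * ‖z‖ ≤ ‖c ^ (2 ^ (j + 1)) - 1‖ + ‖z‖ * ‖z‖ := by
        have h7 := norm_mul_le z z
        have h8 : ‖2 • z‖ = 2 * ‖z‖ := by
          rw [← Nat.cast_smul_eq_nsmul ℂ, norm_smul]; simp
        rw [← h8, e2]
        exact (norm_sub_le _ _).trans (by linarith)
      have h6 : ‖z‖ ≤ 1/2 := h _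
      have := norm_nonneg z
      rw [pow_succ]
      nlinarith
  by_contra hc
  have hpos : 0 < ‖c - 1‖ := norm_pos_iff.2 (sub_ne_zero.2 hc)
  obtain ⟨j, hj⟩ := pow_unbounded_of_one_lt (1 / ‖c - 1‖) (by norm_num : (1:ℝ) < 3 / 2)
  have h1 := key j
  have h2 := h (2 ^ j)
  rw [div_lt_iff₀ hpos] at hj
  linarith

lemma aux_commute {R : Type*} [NormedRing R] [NormedAlgebra ℂ R] [NormOneClass R]
    (K : Subgroup Rˣ) [Finite K] (hK : ∀ u ∈ K, ‖(u : R)‖ ≤ 1) (a b : Rˣ) (ha : a ∈ K) (hb : b ∈ K)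
    (ha1 : ‖(a : R) - 1‖ ≤ 1 / 8) (hb1 : ‖(b : R) - 1‖ ≤ 1 / 8) : Commute a b := by
  by_contra hab
  let S : Set Rˣ := {b | b ∈ K ∧ ‖(b : R) - 1‖ ≤ 1 / 8 ∧ ¬ Commute a b}
  have hS : S.Finite := (Set.toFinite (K : Set Rˣ)).subset fun x hx => hx.1
  obtain ⟨b, ⟨hb, hb1, hab⟩, hmin⟩ := hS.exists_minimalFor (fun b : Rˣ => ‖(b : R) - 1‖) S
    ⟨b, hb, hb1, hab⟩
  set c : Rˣ := a * b * a⁻¹ * b⁻¹ with hc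
  have hcK : c ∈ K := K.mul_mem (K.mul_mem (K.mul_mem ha hb) (K.inv_mem ha)) (K.inv_mem hb)
  have hcn : ‖(c : R) - 1‖ ≤ 2 * ‖(a : R) - 1‖ * ‖(b : R) - 1‖ :=
    aux_comm_norm a b (hK _ (K.inv_mem ha)) (hK _ (K.inv_mem hb))
  have hbpos : 0 < ‖(b : R) - 1‖ := by
    rw [norm_pos_iff, sub_ne_zero]
    intro h
    apply hab
    have : b = 1 := Units.ext h
    rw [this]; exact Commute.one_right a
  have hlt : ‖(c : R) - 1‖ < ‖(b : R) - 1‖ := by nlinarith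
  have hac : Commute a c := by
    by_contra h
    have := hmin (j := c) ⟨hcK, by linarith, h⟩ hlt.le
    linarith
  set a' : Rˣ := b * a * b⁻¹ with ha'
  have hca : c = a * a'⁻¹ := by rw [hc, ha']; group
  have haa : Commute a a' := by
    have h1 : a' = c⁻¹ * a := by rw [hca]; group
    rw [h1]
    exact (hac.inv_right).mul_right (Commute.refl a)
  have hc1 : (c : R) = 1 := by
    apply aux_pow_one
    intro n
    have h2 : c ^ n = a ^ n * b * (a ^ n)⁻¹ * b⁻¹ := by
      rw [hca, (haa.inv_right).mul_pow, inv_pow, ha', conj_pow]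
      group
    have h3 := aux_comm_norm (a ^ n) b (hK _ (K.inv_mem (K.pow_mem ha n))) (hK _ (K.inv_mem hb))
    rw [← h2] at h3
    have h4 : ‖((a ^ n : Rˣ) : R) - 1‖ ≤ 2 := by
      refine (norm_sub_le _ _).trans ?_
      have := hK _ (K.pow_mem ha n)
      rw [norm_one]; linarith
    rw [Units.val_pow_eq_pow_val c] at h3
    nlinarith [norm_nonneg (((a ^ n : Rˣ) : R) - 1)]
  apply hab
  have : c = 1 := Units.ext hc1
  rw [hc, mul_inv_eq_one, mul_inv_eq_iff_eq_mul] at this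
  exact this

abbrev Euc (d : ℕ) := EuclideanSpace ℂ (Fin d)

lemma aux_jordan (d : ℕ) : ∃ J : ℕ, ∀ (G : Type) [Group G] [Finite G]
    (ρ : G →* (Euc d →L[ℂ] Euc d)), (∀ g, ‖ρ g‖ ≤ 1) →
    ∃ N : Subgroup G, N.Normal ∧ N.index ≤ J ∧ (∀ x ∈ N, ∀ y ∈ N, Commute (ρ x) (ρ y)) ∧
      ((∀ x y : G, x * y = y * x) → N = ⊤) := by
  have hcpt : IsCompact (Metric.closedBall (0 : Euc d →L[ℂ] Euc d) 1) := by
    have : ProperSpace (Euc d →L[ℂ] Euc d) := FiniteDimensional.proper ℂ _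
    exact isCompact_closedBall _ _
  obtain ⟨t, -, htf, ht⟩ := hcpt.finite_cover_balls (e := 1 / 16) (by norm_num)
  refine ⟨t.ncard + 1, ?_⟩
  intro G _ _ ρ hρ
  by_cases hcomm : ∀ x y : G, x * y = y * x
  · refine ⟨⊤, inferInstance, by simp, ?_, fun _ => rfl⟩
    intro x _ y _
    rw [Commute, SemiconjBy, ← map_mul, ← map_mul, hcomm]
  by_cases htriv : Subsingleton (Euc d)
  · refine ⟨⊤, inferInstance, by simp, ?_, fun _ => rfl⟩
    intro x _ y _
    ext v
    exact congrFun (congrArg _ (Subsingleton.elim _ _)) _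
  have : Nontrivial (Euc d) := not_subsingleton_iff_nontrivial.1 htriv
  let s : Set G := {g | ‖ρ g - 1‖ ≤ 1 / 8}
  let σ : G →* (Euc d →L[ℂ] Euc d)ˣ := ρ.toHomUnits
  have hσ : ∀ g, ((σ g : (Euc d →L[ℂ] Euc d)ˣ) : Euc d →L[ℂ] Euc d) = ρ g := fun g => rfl
  have hs : ∀ x ∈ s, ∀ y ∈ s, Commute (ρ x) (ρ y) := by
    intro x hx y hy
    have hfin : Finite σ.range := (Set.finite_range σ).to_subtype
    have := aux_commute σ.range (by rintro _ ⟨g, rfl⟩; exact hρ g) (σ x) (σ y) ⟨x, rfl⟩ ⟨y, rfl⟩ hx hy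
    exact congrArg Units.val this
  have hconj : ∀ g : G, ∀ x ∈ s, g * x * g⁻¹ ∈ s := by
    intro g x hx
    have e : ρ (g * x * g⁻¹) - 1 = ρ g * (ρ x - 1) * ρ g⁻¹ := by
      rw [mul_sub, sub_mul, mul_one, ← map_mul, ← map_mul, ← map_mul, mul_inv_cancel, map_one]
    change ‖ρ (g * x * g⁻¹) - 1‖ ≤ 1 / 8
    rw [e]
    have hx' : ‖ρ x - 1‖ ≤ 1 / 8 := hx
    calc _ ≤ ‖ρ g‖ * ‖ρ x - 1‖ * ‖ρ g⁻¹‖ := (norm_mul_le _ _).trans (by gcongr; exact norm_mul_le _ _)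
      _ ≤ 1 * (1 / 8) * 1 := by gcongr <;> apply hρ
      _ = _ := by norm_num
  refine ⟨Subgroup.closure s, ?_, ?_, ?_, fun h => absurd h hcomm⟩
  · constructor
    intro n hn g
    induction hn using Subgroup.closure_induction with
    | mem x hx => exact Subgroup.subset_closure (hconj g x hx)
    | one => simp
    | mul x y _ _ hx hy =>
      have : g * (x * y) * g⁻¹ = (g * x * g⁻¹) * (g * y * g⁻¹) := by group
      rw [this]; exact mul_mem hx hy
    | inv x _ hx =>
      have : g * x⁻¹ * g⁻¹ = (g * x * g⁻¹)⁻¹ := by group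
      rw [this]; exact inv_mem hx
  · have hc : ∀ q : G ⧸ Subgroup.closure s, ∃ p : t, ‖ρ q.out - p‖ < 1 / 16 := by
      intro q
      have := ht (show ρ q.out ∈ Metric.closedBall 0 1 by simpa using hρ _)
      simp only [Set.mem_iUnion, Metric.mem_ball, dist_eq_norm, exists_prop] at this
      obtain ⟨p, hp, h⟩ := this
      exact ⟨⟨p, hp⟩, h⟩
    choose f hf using hc
    have hinj : Function.Injective f := by
      intro q r hqr
      have h1 := hf q
      have h2 := hf r
      rw [hqr] at h1
      rw [← QuotientGroup.out_eq' q, ← QuotientGroup.out_eq' r, QuotientGroup.eq]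
      apply Subgroup.subset_closure
      change ‖ρ (q.out⁻¹ * r.out) - 1‖ ≤ 1 / 8
      have e : ρ (q.out⁻¹ * r.out) - 1 = ρ q.out⁻¹ * (ρ r.out - ρ q.out) := by
        rw [mul_sub, ← map_mul, ← map_mul, inv_mul_cancel, map_one]
      rw [e]
      have h3 : ‖ρ r.out - ρ q.out‖ ≤ 1 / 8 := by
        have := norm_sub_le (ρ r.out - (f r : Euc d →L[ℂ] Euc d)) (ρ q.out - (f r : Euc d →L[ℂ] Euc d))
        rw [sub_sub_sub_cancel_right] at this
        linarith
      calc _ ≤ ‖ρ q.out⁻¹‖ * ‖ρ r.out - ρ q.out‖ := norm_mul_le _ _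
        _ ≤ 1 * (1 / 8) := by gcongr; apply hρ
        _ = _ := by norm_num
    have := htf.to_subtype
    have := Nat.card_le_card_of_injective f hinj
    rw [Subgroup.index]
    have h2 : Nat.card t = t.ncard := rfl
    omega
  · intro x hx y hy
    induction hx, hy using Subgroup.closure_induction₂ with
    | mem x y hx hy => exact hs x hx y hy
    | one_left x _ => rw [map_one]; exact Commute.one_left _
    | one_right x _ => rw [map_one]; exact Commute.one_right _
    | mul_left x y z _ _ _ h1 h2 => rw [map_mul]; exact h1.mul_left h2
    | mul_right y z x _ _ _ h1 h2 => rw [map_mul]; exact h1.mul_right h2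
    | inv_left x y _ _ h =>
      have h' : Commute (σ x) (σ y) := Units.ext h
      have := h'.inv_left
      rw [← map_inv] at this
      exact congrArg Units.val this
    | inv_right x y _ _ h =>
      have h' : Commute (σ x) (σ y) := Units.ext h
      have := h'.inv_right
      rw [← map_inv] at this
      exact congrArg Units.val this



lemma aux_circle (z : ℂ) (hz : ‖z‖ = 1) : ∃ t : AddCircle (1 : ℝ), (AddCircle.toCircle t : ℂ) = z := by
  have : Fact ((0:ℝ) < 1) := ⟨one_pos⟩
  refine ⟨(AddCircle.homeomorphCircle one_ne_zero).symm ⟨z, by simp [Submonoid.unitSphere, hz]⟩, ?_⟩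
  rw [← AddCircle.homeomorphCircle_apply one_ne_zero]
  exact congrArg Subtype.val (Homeomorph.apply_symm_apply _ _)

lemma aux_circle_norm (t : AddCircle (1 : ℝ)) : ‖(AddCircle.toCircle t : ℂ) - 1‖ ≤ 7 * ‖t‖ := by
  induction t using QuotientAddGroup.induction_on with
  | H r =>
    have h1 : (QuotientAddGroup.mk r : AddCircle (1 : ℝ)) = ((r - round r : ℝ) : AddCircle (1 : ℝ)) := by
      rw [AddCircle.coe_sub]
      have : (((round r : ℤ) : ℝ) : AddCircle (1 : ℝ)) = 0 := by
        rw [AddCircle.coe_eq_zero_iff]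
        exact ⟨round r, by simp⟩
      rw [this, sub_zero]
    have h2 : ‖(QuotientAddGroup.mk r : AddCircle (1 : ℝ))‖ = |r - round r| := UnitAddCircle.norm_eq
    rw [h2, h1, AddCircle.toCircle_apply_mk, Circle.coe_exp, mul_comm _ Complex.I]
    refine Real.norm_exp_I_mul_ofReal_sub_one_le.trans ?_
    rw [Real.norm_eq_abs, abs_mul, div_one, abs_of_pos Real.two_pi_pos]
    gcongr
    linarith [Real.pi_lt_d2]

open Module.End in
lemma aux_diag_basis {d : ℕ} {H : Type} [Group H] (ρ : H →* (Euc d →L[ℂ] Euc d))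
    (hρ : ∀ g, ‖ρ g‖ ≤ 1) (hcomm : ∀ x y, Commute (ρ x) (ρ y)) :
    ∃ b : OrthonormalBasis (Fin d) ℂ (Euc d), ∃ c : H → Fin d → ℂ, ∀ h i, ρ h (b i) = c h i • b i := by
  classical
  have hnorm : ∀ h v, ‖ρ h v‖ = ‖v‖ := by
    intro h v
    have h1 : ∀ h v, ‖ρ h v‖ ≤ ‖v‖ := fun h v => by
      simpa using (ρ h).le_of_opNorm_le (hρ h) v
    apply le_antisymm (h1 h v)
    have := h1 h⁻¹ (ρ h v)
    rwa [← mul_apply_eq_comp, ← map_mul, inv_mul_cancel, map_one,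
      one_apply_eq_self] at this
  have hinv : ∀ h v, ρ h (ρ h⁻¹ v) = v := fun h v => by
    rw [← mul_apply_eq_comp, ← map_mul, mul_inv_cancel, map_one,
      one_apply_eq_self]
  have hinner : ∀ h v w, inner ℂ (ρ h v) (ρ h w) = inner ℂ v w := by
    intro h v w
    exact (LinearMap.norm_map_iff_inner_map_map (ρ h)).1 (hnorm h) v w
  have hadj : ∀ h v w, inner ℂ (ρ h v) w = inner ℂ v (ρ h⁻¹ w) := by
    intro h v w
    conv_lhs => rw [← hinv h w]
    exact hinner _ _ _
  let T : H × Bool → (Euc d →ₗ[ℂ] Euc d) := fun p =>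
    if p.2 then ((ρ p.1 + ρ p.1⁻¹ : Euc d →L[ℂ] Euc d) : Euc d →ₗ[ℂ] Euc d)
    else ((Complex.I • (ρ p.1 - ρ p.1⁻¹) : Euc d →L[ℂ] Euc d) : Euc d →ₗ[ℂ] Euc d)
  have hT : ∀ p, (T p).IsSymmetric := by
    rintro ⟨h, b⟩ v w
    have h1 := hadj h v w
    have h2 := hadj h⁻¹ v w
    rw [inv_inv] at h2
    cases b
    · simp [T, inner_add_left, inner_add_right, inner_sub_left, inner_sub_right, inner_smul_left,
        inner_smul_right, h1, h2]
      ring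
    · simp [T, inner_add_left, inner_add_right, h1, h2, add_comm]
  have hC : Pairwise (Function.onFun Commute T) := by
    rintro ⟨h, b⟩ ⟨k, e⟩ -
    have hc : ∀ x y v, ρ x (ρ y v) = ρ y (ρ x v) := fun x y v =>
      congrFun (congrArg DFunLike.coe (hcomm x y)) v
    show Commute (T (h, b)) (T (k, e))
    apply LinearMap.ext
    intro v
    cases b <;> cases e <;>
    · simp only [T, Module.End.mul_apply, ContinuousLinearMap.coe_coe, if_true, if_false,
        add_apply, sub_apply, map_add, map_sub, map_smul,
        smul_apply, Bool.false_eq_true]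
      simp only [hc k h, hc k h⁻¹, hc k⁻¹ h, hc k⁻¹ h⁻¹]
      module
  have htop := LinearMap.IsSymmetric.iSup_iInf_eq_top_of_commute hT hC
  have horth := LinearMap.IsSymmetric.orthogonalFamily_iInf_eigenspaces hT
  set V : (H × Bool → ℂ) → Submodule ℂ (Euc d) := fun γ => ⨅ j, eigenspace (T j) (γ j) with hV
  have : Fintype {γ // V γ ≠ ⊥} := horth.independent.fintypeNeBotOfFiniteDimensional
  have horth' : OrthogonalFamily ℂ (fun i : {γ // V γ ≠ ⊥} => V i) fun i => (V i).subtypeₗᵢ :=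
    horth.comp Subtype.val_injective
  have hint : DirectSum.IsInternal (fun i : {γ // V γ ≠ ⊥} => V i) := by
    rw [horth'.isInternal_iff, Submodule.orthogonal_eq_bot_iff, iSup_ne_bot_subtype]
    exact htop
  have hn : Module.finrank ℂ (Euc d) = d := by simp
  let b := hint.subordinateOrthonormalBasis hn horth'
  have hb : ∀ i, ∃ γ, b i ∈ V γ := fun i =>
    ⟨_, hint.subordinateOrthonormalBasis_subordinate hn i horth'⟩
  choose γ hγ using hb
  refine ⟨b, fun h i => (γ i (h, true) - Complex.I * γ i (h, false)) / 2, ?_⟩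
  intro h i
  have h1 := mem_eigenspace_iff.1 ((Submodule.mem_iInf _).1 (hγ i) (h, true))
  have h2 := mem_eigenspace_iff.1 ((Submodule.mem_iInf _).1 (hγ i) (h, false))
  simp [T] at h1 h2
  have h3 : ρ h (b i) = (1 / 2 : ℂ) • ((ρ h (b i) + ρ h⁻¹ (b i)) -
    Complex.I • (Complex.I • (ρ h (b i) - ρ h⁻¹ (b i)))) := by
    rw [smul_smul Complex.I, Complex.I_mul_I]
    module
  rw [h3, h1, h2]
  module

lemma aux_diag {d : ℕ} {H : Type} [Group H] (ρ : H →* (Euc d →L[ℂ] Euc d))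
    (hρ : ∀ g, ‖ρ g‖ ≤ 1) (hcomm : ∀ x y, Commute (ρ x) (ρ y)) :
    ∃ τ : H →* Multiplicative (Torus (d + 1)), ∀ h (δ : ℝ), 
      dist (0 : Torus (d + 1)) (Multiplicative.toAdd (τ h)) < δ → ‖ρ h - 1‖ ≤ d * (7 * δ) := by
  obtain ⟨b, c, hbc⟩ := aux_diag_basis ρ hρ hcomm
  have hc : ∀ h i, ‖c h i‖ ≤ 1 := by
    intro h i
    have h1 := (ρ h).le_of_opNorm_le (hρ h) (b i)
    rw [hbc, norm_smul] at h1
    simpa using h1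
  have hne : ∀ i, b i ≠ 0 := fun i => b.orthonormal.ne_zero i
  have hmul : ∀ g h i, c (g * h) i = c g i * c h i := by
    intro g h i
    have : ρ (g * h) (b i) = (c g i * c h i) • b i := by
      rw [map_mul, mul_apply_eq_comp, hbc h, map_smul, hbc g, smul_smul, mul_comm]
    rw [hbc] at this
    exact smul_left_injective ℂ (hne i) this
  have hone : ∀ i, c 1 i = 1 := by
    intro i
    have := hbc 1 i
    rw [map_one, one_apply_eq_self] at this
    exact smul_left_injective ℂ (hne i) (by simpa using this.symm)
  have hc1 : ∀ h i, ‖c h i‖ = 1 := by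
    intro h i
    have h1 := hmul h h⁻¹ i
    rw [mul_inv_cancel, hone] at h1
    have h2 := congrArg norm h1
    rw [norm_one, norm_mul] at h2
    have := hc h i
    have := hc h⁻¹ i
    nlinarith [norm_nonneg (c h i)]
  choose t ht using fun h i => aux_circle (c h i) (hc1 h i)
  have htmul : ∀ g h i, t (g * h) i = t g i + t h i := by
    intro g h i
    apply AddCircle.injective_toCircle one_ne_zero
    rw [AddCircle.toCircle_add]
    apply Circle.ext
    rw [Circle.coe_mul, ht, ht, ht, hmul]
  refine ⟨MonoidHom.mk' (fun h => Multiplicative.ofAdd (Fin.cons 0 (t h))) ?_, ?_⟩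
  · intro g h
    rw [← ofAdd_add]
    congr 1
    funext i
    refine Fin.cases ?_ (fun i => ?_) i
    · simp
    · simp [htmul]
  · intro h δ hδ
    have hδ0 : 0 < δ := dist_nonneg.trans_lt hδ
    have hti : ∀ i, ‖t h i‖ ≤ δ := by
      intro i
      have h1 := (dist_le_pi_dist (0 : Torus (d+1)) _ i.succ).trans hδ.le
      simpa [dist_eq_norm] using h1
    have hci : ∀ i, ‖c h i - 1‖ ≤ 7 * δ := by
      intro i
      rw [← ht]
      exact (aux_circle_norm _).trans (by linarith [hti i])
    refine ContinuousLinearMap.opNorm_le_bound _ (by positivity) ?_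
    intro v
    have e : (ρ h - 1) v = ∑ i, (inner ℂ (b i) v * (c h i - 1)) • b i := by
      conv_lhs => rw [← b.sum_repr' v]
      rw [map_sum]
      refine Finset.sum_congr rfl fun i _ => ?_
      rw [map_smul, sub_apply, hbc, one_apply_eq_self]
      module
    rw [e]
    calc _ ≤ ∑ i : Fin d, ‖(inner ℂ (b i) v * (c h i - 1)) • b i‖ := norm_sum_le _ _
      _ ≤ ∑ i : Fin d, ‖v‖ * (7 * δ) := by
        refine Finset.sum_le_sum fun i _ => ?_
        rw [norm_smul, norm_mul, b.norm_eq_one, mul_one]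
        gcongr
        · simpa using norm_inner_le_norm (𝕜 := ℂ) (b i) v
        · exact hci i
      _ = _ := by simp; ring



open ContinuousLinearMap in
lemma aux_spec {G E : Type} [Group G] [NormedAddCommGroup E] [InnerProductSpace ℂ E]
    [FiniteDimensional ℂ E] (T : E →L[ℂ] E) (L : G →* (E →L[ℂ] E))
    (hL : ∀ g v, ‖L g v‖ = ‖v‖) (hTL : ∀ g v, T (L g v) = L g (T v)) (t M κ : ℝ) (ht : 0 < t)
    (hκ : ∀ v, ‖T v‖ ≤ κ * ‖v‖) (hκ0 : 0 ≤ κ)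
    (hM : ∀ b : OrthonormalBasis (Fin (Module.finrank ℂ E)) ℂ E, ∑ i, ‖T (b i)‖ ^ 2 ≤ M) :
    ∃ d : ℕ, d * t ≤ M ∧ ∃ ρ : G →* (Euc d →L[ℂ] Euc d), (∀ g, ‖ρ g‖ ≤ 1) ∧
      ∀ x f, ‖inner ℂ (T f) (T f) - inner ℂ (T f) (T (L x f))‖
        ≤ ‖ρ x - 1‖ * κ ^ 2 * ‖f‖ ^ 2 + 2 * t * ‖f‖ ^ 2 := by
  classical
  have : CompleteSpace E := FiniteDimensional.complete ℂ E
  have hLi : ∀ h v w, inner ℂ (L h v) (L h w) = inner ℂ v w := by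
    intro h v w
    exact (LinearMap.norm_map_iff_inner_map_map (L h)).1 (hL h) v w
  have hinv : ∀ h v, L h (L h⁻¹ v) = v := fun h v => by
    rw [← mul_apply_eq_comp, ← map_mul, mul_inv_cancel, map_one, one_apply_eq_self]
  let S : E →L[ℂ] E := (adjoint T).comp T
  have hSin : ∀ v w, inner ℂ v (S w) = inner ℂ (T v) (T w) := by
    intro v w
    simp [S, adjoint_inner_right]
  have hSin' : ∀ v w, inner ℂ (S v) w = inner ℂ (T v) (T w) := by
    intro v w
    simp [S, adjoint_inner_left]
  have hSL : ∀ g v, S (L g v) = L g (S v) := by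
    intro g v
    apply ext_inner_left ℂ
    intro w
    rw [hSin, hTL]
    conv_lhs => rw [← hinv g w]
    conv_rhs => rw [← hinv g w]
    rw [hTL, hLi, hLi, hSin]
  have hsym : (S : E →ₗ[ℂ] E).IsSymmetric := by
    intro v w
    simp only [coe_coe]
    rw [hSin, hSin']
  let b := hsym.eigenvectorBasis rfl
  let lam := hsym.eigenvalues rfl
  have hb : ∀ i, S (b i) = (lam i : ℂ) • b i := fun i => hsym.apply_eigenvectorBasis rfl i
  have hlam : ∀ i, lam i = ‖T (b i)‖ ^ 2 := by
    intro i
    have h1 := hSin (b i) (b i)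
    rw [hb, inner_smul_right, inner_self_eq_norm_sq_to_K, inner_self_eq_norm_sq_to_K,
      b.norm_eq_one] at h1
    simp at h1
    exact_mod_cast h1
  let J : Finset (Fin (Module.finrank ℂ E)) := Finset.univ.filter fun i => t ≤ lam i
  let V : Submodule ℂ E := Submodule.span ℂ (b '' J)
  have hJ : (J.card : ℝ) * t ≤ M := by
    calc (J.card : ℝ) * t = ∑ i ∈ J, t := by simp
      _ ≤ ∑ i ∈ J, lam i := Finset.sum_le_sum fun i hi => (Finset.mem_filter.1 hi).2
      _ ≤ ∑ i, lam i := Finset.sum_le_sum_of_subset_of_nonneg (Finset.subset_univ _)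
          fun i _ _ => by rw [hlam]; positivity
      _ = ∑ i, ‖T (b i)‖ ^ 2 := by simp only [hlam]
      _ ≤ M := hM b
  have hVinv : ∀ g, ∀ v ∈ V, L g v ∈ V := by
    intro g v hv
    induction hv using Submodule.span_induction with
    | zero => simp
    | add x y _ _ hx hy => rw [map_add]; exact V.add_mem hx hy
    | smul a x _ hx => rw [map_smul]; exact V.smul_mem _ hx
    | mem x hx =>
      obtain ⟨i, hi, rfl⟩ := hx
      rw [← b.sum_repr' (L g (b i))]
      refine V.sum_mem fun j _ => ?_
      by_cases hj : j ∈ J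
      · exact V.smul_mem _ (Submodule.subset_span ⟨j, hj, rfl⟩)
      · have h1 : inner ℂ (b j) (S (L g (b i))) = inner ℂ (S (b j)) (L g (b i)) := by
          rw [hSin, hSin']
        rw [hSL, hb, hb, map_smul, inner_smul_right, inner_smul_left] at h1
        have h2 : lam i ≠ lam j := by
          intro h
          apply hj
          simp only [J, Finset.mem_filter, Finset.mem_univ, true_and, Finset.mem_coe] at hi ⊢
          rwa [← h]
        have h3 : inner ℂ (b j) (L g (b i)) = 0 := by
          by_contra h4
          apply h2
          simp only [Complex.conj_ofReal] at h1
          exact_mod_cast mul_right_cancel₀ h4 h1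
        rw [h3, zero_smul]; exact V.zero_mem
  have hSw : ∀ w ∈ Vᗮ, ‖S w‖ ≤ t * ‖w‖ := by
    intro w hw
    have h1 : ∀ i, ‖inner ℂ (b i) (S w)‖ ≤ t * ‖inner ℂ (b i) w‖ := by
      intro i
      have h2 : inner ℂ (b i) (S w) = lam i * inner ℂ (b i) w := by
        rw [hSin, ← hSin', hb, inner_smul_left, Complex.conj_ofReal]
      rw [h2]
      by_cases hi : i ∈ J
      · have : inner ℂ (b i) w = 0 := hw (b i) (Submodule.subset_span ⟨i, hi, rfl⟩)
        rw [this]; simp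
      · rw [norm_mul]
        gcongr
        simp only [J, Finset.mem_filter, Finset.mem_univ, true_and, not_le] at hi
        rw [Complex.norm_real, Real.norm_eq_abs, abs_of_nonneg (by rw [hlam]; positivity)]
        exact hi.le
    have h3 : ‖S w‖ ^ 2 ≤ (t * ‖w‖) ^ 2 := by
      rw [mul_pow, ← b.sum_sq_norm_inner_right, ← b.sum_sq_norm_inner_right, Finset.mul_sum]
      refine Finset.sum_le_sum fun i _ => ?_
      rw [← mul_pow]
      gcongr
      exact h1 i
    exact le_of_sq_le_sq h3 (by positivity)
  refine ⟨Module.finrank ℂ V, ?_, ?_⟩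
  · have h1 : Module.finrank ℂ V ≤ J.card := by
      have : V = Submodule.span ℂ ((J.image b : Finset E) : Set E) := by simp [V]
      rw [this]
      exact (finrank_span_finset_le_card _).trans Finset.card_image_le
    have : (Module.finrank ℂ V : ℝ) ≤ J.card := by exact_mod_cast h1
    nlinarith
  let e0 : Euc (Module.finrank ℂ V) →ₗᵢ[ℂ] E :=
    V.subtypeₗᵢ.comp (stdOrthonormalBasis ℂ V).repr.symm.toLinearIsometry
  let e : Euc (Module.finrank ℂ V) →L[ℂ] E := e0.toContinuousLinearMap
  have he : ∀ u, e u ∈ V := fun u => ((stdOrthonormalBasis ℂ V).repr.symm u).2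
  have hesurj : ∀ v ∈ V, ∃ u, e u = v := by
    intro v hv
    exact ⟨(stdOrthonormalBasis ℂ V).repr ⟨v, hv⟩, by simp [e, e0]⟩
  have hen : ∀ u, ‖e u‖ = ‖u‖ := fun u => e0.norm_map u
  have hein : ∀ u v, inner ℂ (e u) (e v) = inner ℂ u v := fun u v => e0.inner_map_map u v
  have hee : ∀ u, adjoint e (e u) = u := by
    intro u
    apply ext_inner_left ℂ
    intro w
    rw [adjoint_inner_right, hein]
  have hee' : ∀ v ∈ V, e (adjoint e v) = v := by
    intro v hv
    obtain ⟨u, rfl⟩ := hesurj v hv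
    rw [hee]
  have hadjn : ∀ v, ‖adjoint e v‖ ≤ ‖v‖ := by
    intro v
    have h1 : ‖e‖ ≤ 1 := e.opNorm_le_bound zero_le_one fun u => by rw [hen, one_mul]
    have h2 : ‖adjoint e‖ ≤ 1 := by rw [LinearIsometryEquiv.norm_map]; exact h1
    simpa using (adjoint e).le_of_opNorm_le h2 v
  let ρ : G →* (Euc (Module.finrank ℂ V) →L[ℂ] Euc (Module.finrank ℂ V)) :=
    { toFun := fun g => (adjoint e).comp ((L g).comp e)
      map_one' := by
        ext1 u
        simp [hee]
      map_mul' := by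
        intro g h
        ext1 u
        simp only [comp_apply, map_mul, mul_apply_eq_comp]
        rw [hee' _ (hVinv _ _ (he u))] }
  have hρ : ∀ g u, ρ g u = adjoint e (L g (e u)) := fun g u => rfl
  refine ⟨ρ, ?_, ?_⟩
  · intro g
    refine opNorm_le_bound _ zero_le_one fun u => ?_
    rw [hρ, one_mul]
    exact (hadjn _).trans (by rw [hL, hen])
  intro x f
  have hw : f - e (adjoint e f) ∈ Vᗮ := by
    intro v hv
    obtain ⟨u, rfl⟩ := hesurj v hv
    rw [inner_sub_right, hein, adjoint_inner_right, sub_self]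
  set u := adjoint e f with hu
  set w := f - e u with hwdef
  have hwn : ‖w‖ ≤ ‖f‖ := by
    have h1 : inner ℂ (e u) w = 0 := hw _ (he u)
    have h2 : f = e u + w := by rw [hwdef]; abel
    have h3 := norm_add_sq_eq_norm_sq_add_norm_sq_of_inner_eq_zero _ _ h1
    rw [← h2] at h3
    nlinarith [norm_nonneg w, norm_nonneg f, norm_nonneg (e u)]
  have h1 : inner ℂ (T f) (T f) - inner ℂ (T f) (T (L x f))
      = - inner ℂ (T f) (T (L x (e u) - e u)) + inner ℂ f (S w - L x (S w)) := by
    have h2 : f = e u + w := by rw [hwdef]; abel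
    have h3 : inner ℂ f (S w - L x (S w)) = inner ℂ (T f) (T w) - inner ℂ (T f) (T (L x w)) := by
      rw [← hSL, inner_sub_right, hSin, hSin]
    rw [h3]
    have h4 : T f = T (e u) + T w := by rw [← map_add, ← h2]
    have h5 : T (L x f) = T (L x (e u)) + T (L x w) := by rw [← map_add, ← map_add, ← h2]
    have h6 : inner ℂ (T f) (T f) = inner ℂ (T f) (T (e u)) + inner ℂ (T f) (T w) := by
      rw [← inner_add_right, ← h4]
    have h7 : inner ℂ (T f) (T (L x (e u) - e u))
        = inner ℂ (T f) (T (L x (e u))) - inner ℂ (T f) (T (e u)) := by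
      rw [map_sub, inner_sub_right]
    have h8 : inner ℂ (T f) (T (L x f))
        = inner ℂ (T f) (T (L x (e u))) + inner ℂ (T f) (T (L x w)) := by
      rw [h5, inner_add_right]
    rw [h7, h8]
    linear_combination h6
  have h2 : ‖L x (e u) - e u‖ ≤ ‖ρ x - 1‖ * ‖f‖ := by
    have h3 : L x (e u) - e u = e ((ρ x - 1) u) := by
      rw [sub_apply, one_apply_eq_self, map_sub, hρ, hee' _ (hVinv _ _ (he u))]
    rw [h3, hen]
    refine (le_opNorm _ _).trans ?_
    gcongr
    exact hadjn f
  have h3 : ‖S w - L x (S w)‖ ≤ 2 * t * ‖f‖ := by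
    refine (norm_sub_le _ _).trans ?_
    rw [hL]
    have := hSw w hw
    nlinarith
  rw [h1]
  refine (norm_add_le _ _).trans ?_
  rw [norm_neg]
  have h4 := norm_inner_le_norm (𝕜 := ℂ) (T f) (T (L x (e u) - e u))
  have h5 := norm_inner_le_norm (𝕜 := ℂ) f (S w - L x (S w))
  have h6 : ‖T f‖ * ‖T (L x (e u) - e u)‖ ≤ (κ * ‖f‖) * (κ * (‖ρ x - 1‖ * ‖f‖)) := by
    gcongr
    · exact hκ f
    · exact (hκ _).trans (by gcongr)
  have h7 : ‖f‖ * ‖S w - L x (S w)‖ ≤ ‖f‖ * (2 * t * ‖f‖) := by gcongr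
  nlinarith



/-- left translation -/
noncomputable def auxL (G : Type) [Group G] [Fintype G] :
    G →* (EuclideanSpace ℂ G →L[ℂ] EuclideanSpace ℂ G) where
  toFun x := (LinearIsometryEquiv.piLpCongrLeft 2 ℂ ℂ (Equiv.mulLeft x)).toContinuousLinearEquiv.toContinuousLinearMap
  map_one' := by
    ext f y
    simp [LinearIsometryEquiv.piLpCongrLeft_apply]
    rfl
  map_mul' x z := by
    ext f y
    simp [LinearIsometryEquiv.piLpCongrLeft_apply]
    change f.ofLp (z⁻¹ * (x⁻¹ * y)) = _
    rfl

theorem auxL_apply {G : Type} [Group G] [Fintype G] (x y : G) (f : EuclideanSpace ℂ G) :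
    auxL G x f y = f (x⁻¹ * y) := by
  simp [auxL, LinearIsometryEquiv.piLpCongrLeft_apply]

theorem auxL_norm {G : Type} [Group G] [Fintype G] (x : G) (f : EuclideanSpace ℂ G) :
    ‖auxL G x f‖ = ‖f‖ := 
  (LinearIsometryEquiv.piLpCongrLeft 2 ℂ ℂ (Equiv.mulLeft x)).norm_map f

/-- right convolution -/
noncomputable def auxT {G : Type} [Group G] [Fintype G] (C : Finset G) :
    EuclideanSpace ℂ G →L[ℂ] EuclideanSpace ℂ G :=
  LinearMap.toContinuousLinearMap
  { toFun := fun f => WithLp.toLp 2 (fun y => ∑ c ∈ C, f (y * c))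
    map_add' := by
      intro f g
      ext y
      simp [Finset.sum_add_distrib]
    map_smul' := by
      intro r f
      ext y
      simp [Finset.mul_sum] }

theorem auxT_apply {G : Type} [Group G] [Fintype G] (C : Finset G) (f : EuclideanSpace ℂ G) (y : G) :
    auxT C f y = ∑ c ∈ C, f (y * c) := by
  simp [auxT]

theorem auxT_bound {G : Type} [Group G] [Fintype G] (C : Finset G) (f : EuclideanSpace ℂ G) :
    ‖auxT C f‖ ≤ C.card * ‖f‖ := by
  rw [← Real.sqrt_sq (norm_nonneg f), ← Real.sqrt_sq (norm_nonneg (auxT C f)), EuclideanSpace.norm_sq_eq,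
    EuclideanSpace.norm_sq_eq]
  rw [← Real.sqrt_sq (Nat.cast_nonneg (α := ℝ) C.card), ← Real.sqrt_mul (by positivity)]
  apply Real.sqrt_le_sqrt
  have h1 : ∀ y, ‖auxT C f y‖ ^ 2 ≤ C.card * ∑ c ∈ C, ‖f (y * c)‖ ^ 2 := by
    intro y
    rw [auxT_apply]
    calc _ ≤ (∑ c ∈ C, ‖f (y * c)‖) ^ 2 := by gcongr; exact norm_sum_le _ _
      _ ≤ _ := sq_sum_le_card_mul_sum_sq
  calc _ ≤ ∑ y, (C.card : ℝ) * ∑ c ∈ C, ‖f (y * c)‖ ^ 2 := Finset.sum_le_sum fun y _ => h1 y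
    _ = C.card * ∑ c ∈ C, ∑ y, ‖f (y * c)‖ ^ 2 := by rw [← Finset.mul_sum, Finset.sum_comm]
    _ = C.card * ∑ c ∈ C, ∑ y, ‖f y‖ ^ 2 := by
      congr 1
      refine Finset.sum_congr rfl fun c _ => ?_
      exact Equiv.sum_comp (Equiv.mulRight c) (fun y => ‖f y‖ ^ 2)
    _ = _ := by rw [Finset.sum_const, nsmul_eq_mul]; ring

theorem auxT_HS {G : Type} [Group G] [Fintype G] [DecidableEq G] (C : Finset G) {ι : Type} [Fintype ι]
    (b : OrthonormalBasis ι ℂ (EuclideanSpace ℂ G)) :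
    ∑ i, ‖auxT C (b i)‖ ^ 2 ≤ (Fintype.card G : ℝ) ^ 2 := by
  have h1 : ∀ y, ∑ i, ‖auxT C (b i) y‖ ^ 2 ≤ (Fintype.card G : ℝ) := by
    intro y
    let v : EuclideanSpace ℂ G := WithLp.toLp 2 (fun z => if y⁻¹ * z ∈ C then 1 else 0)
    have h2 : ∀ f : EuclideanSpace ℂ G, auxT C f y = inner ℂ v f := by
      intro f
      rw [auxT_apply, PiLp.inner_apply]
      rw [← Equiv.sum_comp (Equiv.mulLeft y)]
      simp [v, Finset.sum_ite_mem]
    simp_rw [h2]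
    rw [b.sum_sq_norm_inner_left, EuclideanSpace.norm_sq_eq]
    calc _ ≤ ∑ z : G, (1 : ℝ) := by
          apply Finset.sum_le_sum
          intro z _
          simp only [v]
          split_ifs <;> simp
      _ = _ := by simp
  simp_rw [EuclideanSpace.norm_sq_eq]
  rw [Finset.sum_comm]
  calc _ ≤ ∑ y : G, (Fintype.card G : ℝ) := Finset.sum_le_sum fun y _ => h1 y
    _ = _ := by simp; ring

theorem aux_L4 {G : Type} [Group G] [Fintype G] [DecidableEq G] (A C : Finset G) (K : ℕ) (hK : 0 < K)
    (hA : Fintype.card G ≤ K * A.card) (hC : Fintype.card G ≤ K * C.card) :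
    ∃ d : ℕ, d ≤ 8 * K ^ 3 ∧ ∃ ρ : G →* (Euc d →L[ℂ] Euc d), (∀ g, ‖ρ g‖ ≤ 1) ∧
      ∀ x, ‖ρ x - 1‖ ≤ 1 / (2 * K) → x ∈ A * C⁻¹ * C * A⁻¹ := by
  have hG : (0 : ℝ) < Fintype.card G := by exact_mod_cast Fintype.card_pos
  obtain ⟨g, hg⟩ : ∃ g : ℝ, g = ((Fintype.card G : ℕ) : ℝ) := ⟨_, rfl⟩
  rw [← hg] at hG
  have hK' : (0 : ℝ) < K := by exact_mod_cast hK
  have hA' : g ≤ K * A.card := by rw [hg]; exact_mod_cast hA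
  have hC' : g ≤ K * C.card := by rw [hg]; exact_mod_cast hC
  obtain ⟨d, hd, ρ, hρ, h⟩ := aux_spec (auxT C) (auxL G) (auxL_norm)
    (by
      intro x v
      ext y
      simp [auxT_apply, auxL_apply, mul_assoc])
    (g ^ 2 / (8 * K ^ 3)) (g ^ 2) C.card (by positivity) (auxT_bound C) (by positivity) (by rw [hg]; exact fun b => auxT_HS C b)
  refine ⟨d, ?_, ρ, hρ, ?_⟩
  · have : (d : ℝ) ≤ 8 * K ^ 3 := by
      have h2 : (d : ℝ) * (g ^ 2 / (8 * K ^ 3)) = (d / (8 * K ^ 3)) * g ^ 2 := by ring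
      rw [h2] at hd
      have h3 : (d : ℝ) / (8 * K ^ 3) ≤ 1 := by
        by_contra hlt
        push Not at hlt
        nlinarith [sq_pos_of_pos hG]
      rwa [div_le_one (by positivity)] at h3
    exact_mod_cast this
  intro x hx
  let f : EuclideanSpace ℂ G := WithLp.toLp 2 (fun z => if z ∈ A then 1 else 0)
  have hf : ‖f‖ ^ 2 = A.card := by
    rw [EuclideanSpace.norm_sq_eq]
    simp [f, apply_ite]
  have hTf : ∀ y, auxT C f y ≠ 0 → y ∈ A * C⁻¹ := by
    intro y hy
    rw [auxT_apply] at hy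
    obtain ⟨c, hc, hcy⟩ := Finset.exists_ne_zero_of_sum_ne_zero hy
    have hm : y * c ∈ A := by
      by_contra hn
      exact hcy (by simp [f, hn])
    exact Finset.mem_mul.2 ⟨y * c, hm, c⁻¹, Finset.inv_mem_inv hc, by group⟩
  have hsum : ∑ y, auxT C f y = A.card * C.card := by
    simp_rw [auxT_apply]
    rw [Finset.sum_comm]
    have : ∀ c ∈ C, ∑ y, f (y * c) = A.card := by
      intro c _
      refine (Equiv.sum_comp (Equiv.mulRight c) (fun y => f y)).trans ?_
      simp [f]
    rw [Finset.sum_congr rfl this]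
    simp; ring
  have hlow : (A.card * C.card : ℝ) ^ 2 ≤ g * ‖auxT C f‖ ^ 2 := by
    rw [EuclideanSpace.norm_sq_eq]
    have h1 : (A.card * C.card : ℝ) ≤ ∑ y, ‖auxT C f y‖ := by
      have := norm_sum_le Finset.univ (fun y => auxT C f y)
      rw [hsum] at this
      simpa using this
    calc _ ≤ (∑ y, ‖auxT C f y‖) ^ 2 := by gcongr
      _ ≤ _ := by
        have := sq_sum_le_card_mul_sum_sq (s := Finset.univ) (f := fun y => ‖auxT C f y‖)
        rw [hg]
        simpa using this
  by_contra hcon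
  have hzero : inner ℂ (auxT C f) (auxT C (auxL G x f)) = 0 := by
    rw [PiLp.inner_apply]
    apply Finset.sum_eq_zero
    intro y _
    by_contra hne
    have e1 : auxT C (auxL G x f) y = auxT C f (x⁻¹ * y) := by
      simp [auxT_apply, auxL_apply, mul_assoc]
    rw [e1] at hne
    have h1 : auxT C f y ≠ 0 := by
      intro h0; rw [h0] at hne; simp at hne
    have h2 : auxT C f (x⁻¹ * y) ≠ 0 := by
      intro h0; rw [h0] at hne; simp at hne
    have h3 := hTf _ h1
    have h4 := hTf _ h2
    apply hcon
    have : x = y * (x⁻¹ * y)⁻¹ := by group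
    rw [this, mul_assoc (A * C⁻¹)]
    refine Finset.mul_mem_mul h3 ?_
    have := Finset.inv_mem_inv h4
    rwa [mul_inv_rev, inv_inv] at this
  have h5 := h x f
  rw [hzero, sub_zero, inner_self_eq_norm_sq_to_K, hf] at h5
  have h6 : ‖((‖auxT C f‖ : ℂ)) ^ 2‖ = ‖auxT C f‖ ^ 2 := by simp
  have h7 : ‖auxT C f‖ ^ 2 ≤ ‖ρ x - 1‖ * C.card ^ 2 * A.card + 2 * (g ^ 2 / (8 * K ^ 3)) * A.card := by
    rw [← h6]; exact h5
  set a : ℝ := ((A.card : ℕ) : ℝ)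
  set c : ℝ := ((C.card : ℕ) : ℝ)
  have ha : 0 < a := by by_contra hn; push Not at hn; nlinarith
  have hc : 0 < c := by by_contra hn; push Not at hn; nlinarith
  have h8 : ‖auxT C f‖ ^ 2 ≤ 1 / (2 * K) * c ^ 2 * a + 2 * (g ^ 2 / (8 * K ^ 3)) * a := by
    refine h7.trans ?_
    gcongr
  have h9 : (a * c) ^ 2 ≤ g * (1 / (2 * K) * c ^ 2 * a + 2 * (g ^ 2 / (8 * K ^ 3)) * a) :=
    hlow.trans (by gcongr)
  have h10 : g * (1 / (2 * K) * c ^ 2 * a) ≤ (a * c) ^ 2 / 2 := by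
    calc _ ≤ (K * a) * (1 / (2 * K) * c ^ 2 * a) := by gcongr
      _ = _ := by field_simp
  have h11 : g * (2 * (g ^ 2 / (8 * K ^ 3)) * a) ≤ (a * c) ^ 2 / 4 := by
    calc _ = g * g ^ 2 / K ^ 3 * a / 4 := by ring
      _ ≤ (K * a) * (K * c) ^ 2 / K ^ 3 * a / 4 := by gcongr
      _ = _ := by field_simp
  have h12 : 0 < (a * c) ^ 2 := by positivity
  rw [mul_add] at h9
  linarith



/-- auxiliary conclusion -/
def AuxGood {G : Type} [Group G] (C : ℕ) (S : Set G) : Prop :=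
  0 < C ∧ ∃ H : Subgroup G, H.Normal ∧ H.index ≤ C ∧ ((∀ x y : G, x * y = y * x) → H = ⊤) ∧
    ∃ n : ℕ, 0 < n ∧ n ≤ C ∧ ∃ τ : H →* Multiplicative (Torus n),
      ∀ x : H, dist (0 : Torus n) (Multiplicative.toAdd (τ x)) < (C : ℝ)⁻¹ → (x : G) ∈ S

theorem aux_good_of (K : ℕ) (hK : 0 < K) : ∃ C : ℕ, ∀ (G : Type) [Group G] [Fintype G]
    [DecidableEq G] (A B : Finset G), Fintype.card G ≤ K * A.card → Fintype.card G ≤ K * B.card →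
    AuxGood C ((A * B⁻¹ * B * A⁻¹ : Finset G) : Set G) := by
  choose J hJ using aux_jordan
  let D := 8 * K ^ 3
  refine ⟨∑ d ∈ Finset.range (D + 1), J d + (D + 1) + 14 * (D + 1) * K, ?_⟩
  intro G _ _ _ A B hA hB
  obtain ⟨d, hd, ρ, hρ, hx⟩ := aux_L4 A B K hK hA hB
  obtain ⟨N, hN, hNi, hNc, hNab⟩ := hJ d G ρ hρ
  have hle : J d ≤ ∑ d ∈ Finset.range (D + 1), J d :=
    Finset.single_le_sum (f := J) (fun _ _ => Nat.zero_le _) (Finset.mem_range.2 (by omega))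
  obtain ⟨τ, hτ⟩ := aux_diag (ρ.comp N.subtype) (fun g => hρ _)
    (fun x y => hNc x x.2 y y.2)
  refine ⟨by omega, N, hN, by omega, hNab, d + 1, by omega, by omega, τ, ?_⟩
  intro x hxd
  apply hx
  refine (hτ x _ hxd).trans ?_
  set E : ℕ := ∑ d ∈ Finset.range (D + 1), J d + (D + 1) + 14 * (D + 1) * K with hE
  have hK' : (0 : ℝ) < K := by exact_mod_cast hK
  have h1 : 14 * (D + 1) * K ≤ E := by omega
  have h2 : (14 * (D + 1) * K : ℝ) ≤ E := by exact_mod_cast h1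
  have h3 : (d : ℝ) ≤ D + 1 := by exact_mod_cast (by omega : d ≤ D + 1)
  have h4 : (0 : ℝ) < E := lt_of_lt_of_le (by positivity) h2
  rw [le_div_iff₀ (by positivity)]
  calc (d : ℝ) * (7 * (E : ℝ)⁻¹) * (2 * K) = (14 * d * K) * (E : ℝ)⁻¹ := by ring
    _ ≤ E * (E : ℝ)⁻¹ := by
      gcongr
      refine le_trans ?_ h2
      gcongr
    _ = 1 := mul_inv_cancel₀ h4.ne'

theorem aux_good_inter {G : Type} [Group G] {C₁ C₂ : ℕ} {S₁ S₂ : Set G} (h₁ : AuxGood C₁ S₁)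
    (h₂ : AuxGood C₂ S₂) : AuxGood (C₁ * C₂ + C₁ + C₂) (S₁ ∩ S₂) := by
  obtain ⟨p₁, H₁, N₁, i₁, c₁, n₁, hn₁, hn₁', τ₁, t₁⟩ := h₁
  obtain ⟨p₂, H₂, N₂, i₂, c₂, n₂, hn₂, hn₂', τ₂, t₂⟩ := h₂
  have hpos : 0 < C₁ * C₂ := Nat.mul_pos p₁ p₂
  refine ⟨by omega, H₁ ⊓ H₂, inferInstance, ?_, ?_, n₁ + n₂, by omega, by omega, ?_⟩
  · have h1 := Subgroup.index_inf_le (H := H₁) (K := H₂)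
    have h2 := Nat.mul_le_mul i₁ i₂
    omega
  · intro h
    rw [c₁ h, c₂ h, inf_top_eq]
  let σ₁ : ↥(H₁ ⊓ H₂) →* Multiplicative (Torus n₁) := τ₁.comp (Subgroup.inclusion inf_le_left)
  let σ₂ : ↥(H₁ ⊓ H₂) →* Multiplicative (Torus n₂) := τ₂.comp (Subgroup.inclusion inf_le_right)
  refine ⟨{ toFun := fun x => Multiplicative.ofAdd
              (Fin.append (Multiplicative.toAdd (σ₁ x)) (Multiplicative.toAdd (σ₂ x)))
            map_one' := ?_
            map_mul' := ?_ }, ?_⟩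
  · apply Multiplicative.toAdd.injective
    funext i
    rw [toAdd_ofAdd, map_one σ₁, map_one σ₂]
    refine Fin.addCases (fun j => ?_) (fun j => ?_) i
    · rw [Fin.append_left]; rfl
    · rw [Fin.append_right]; rfl
  · intro x y
    apply Multiplicative.toAdd.injective
    funext i
    rw [toAdd_ofAdd, map_mul σ₁, map_mul σ₂, toAdd_mul, toAdd_mul, toAdd_mul, toAdd_ofAdd,
      toAdd_ofAdd]
    refine Fin.addCases (fun j => ?_) (fun j => ?_) i
    · rw [Fin.append_left, Pi.add_apply, Pi.add_apply, Fin.append_left, Fin.append_left]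
    · rw [Fin.append_right, Pi.add_apply, Pi.add_apply, Fin.append_right, Fin.append_right]
  intro x hx
  simp only [MonoidHom.coe_mk, OneHom.coe_mk, toAdd_ofAdd] at hx
  have q₁ : (0 : ℝ) < C₁ := by exact_mod_cast p₁
  have q₂ : (0 : ℝ) < C₂ := by exact_mod_cast p₂
  have hp := dist_pi_lt_iff (f := (0 : Torus (n₁ + n₂))) (r := ((C₁ * C₂ + C₁ + C₂ : ℕ) : ℝ)⁻¹)
    (by push_cast; positivity) |>.1 hx
  constructor
  · refine t₁ (Subgroup.inclusion inf_le_left x) ?_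
    rw [dist_pi_lt_iff (by positivity)]
    intro j
    have := hp (Fin.castAdd n₂ j)
    rw [Fin.append_left] at this
    refine lt_of_lt_of_le this ?_
    apply inv_anti₀ q₁
    exact_mod_cast (by omega : C₁ ≤ C₁ * C₂ + C₁ + C₂)
  · refine t₂ (Subgroup.inclusion inf_le_right x) ?_
    rw [dist_pi_lt_iff (by positivity)]
    intro j
    have := hp (Fin.natAdd n₁ j)
    rw [Fin.append_right] at this
    refine lt_of_lt_of_le this ?_
    apply inv_anti₀ q₂
    exact_mod_cast (by omega : C₂ ≤ C₁ * C₂ + C₁ + C₂)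

theorem aux_main (K : ℕ) (hK : 0 < K) : ∃ C : ℕ, ∀ (G : Type) [Group G] [Fintype G]
    [DecidableEq G] (A : Finset G), Fintype.card G ≤ K * A.card →
    AuxGood C (((A * A⁻¹) ^ 2 ∩ (A ^ 2 * A⁻¹ ^ 2) ∩ (A⁻¹ * A) ^ 2 ∩ (A⁻¹ ^ 2 * A ^ 2) :
            Finset G) : Set G) := by
  obtain ⟨C, hC⟩ := aux_good_of K hK
  let F : ℕ → ℕ → ℕ := fun a b => a * b + a + b
  refine ⟨F (F (F C C) C) C, fun G _ _ _ A hA => ?_⟩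
  have hA' : Fintype.card G ≤ K * (A⁻¹).card := by rwa [Finset.card_inv]
  have h1 := hC G A A hA hA
  have h2 := hC G A A⁻¹ hA hA'
  have h3 := hC G A⁻¹ A⁻¹ hA' hA'
  have h4 := hC G A⁻¹ A hA' hA
  have h := aux_good_inter (aux_good_inter (aux_good_inter h1 h2) h3) h4
  simp only [inv_inv] at h
  simp only [Finset.coe_inter, pow_two]
  simpa only [mul_assoc] using h

theorem aux_trip {G : Type} [Group G] [DecidableEq G] (k m : ℕ) (A : Finset G)
    (hA : A.Nonempty) (h3 : (A ^ 3).card ≤ k * A.card) :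
    ((A ∪ A⁻¹ ∪ (1 : Finset G)) ^ m).card ≤ (27 * k ^ 3) ^ (m + 1) * 3 * A.card := by
  set S := A ∪ A⁻¹ ∪ (1 : Finset G) with hS
  have h3' : ((A ^ 3).card : ℝ) ≤ (k : ℝ) * A.card := by exact_mod_cast h3
  have hw : ∀ i j l : ℤ, |i| = 1 → |j| = 1 → |l| = 1 →
      (A ^ i * A ^ j * A ^ l).card ≤ k ^ 3 * A.card := by
    intro i j l hi hj hl
    have := Finset.small_alternating_pow_of_small_tripling (m := 3) le_rfl h3' ![i, j, l]
      (by intro t; fin_cases t <;> simp [hi, hj, hl])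
    simp [List.finRange_succ] at this
    rw [← mul_assoc] at this
    exact_mod_cast this
  have hne : ∀ i : ℤ, |i| = 1 → (A ^ i).Nonempty := by
    intro i hi
    rcases (abs_eq (zero_le_one)).1 hi with rfl | rfl
    · simpa using hA
    · simpa using hA
  have hw2 : ∀ i j : ℤ, |i| = 1 → |j| = 1 → (A ^ i * A ^ j).card ≤ k ^ 3 * A.card := by
    intro i j hi hj
    exact (Finset.card_le_card_mul_right (hne 1 (by simp))).trans (hw i j 1 hi hj (by simp))
  have hw1 : ∀ i : ℤ, |i| = 1 → (A ^ i).card ≤ k ^ 3 * A.card := by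
    intro i hi
    exact (Finset.card_le_card_mul_right (hne 1 (by simp))).trans (hw2 i 1 hi (by simp))
  have hw0 : 1 ≤ k ^ 3 * A.card := (Nat.succ_le_of_lt (Finset.card_pos.2 (hne 1 (by simp)))).trans (hw1 1 (by simp))
  let I : Finset ℤ := {1, -1, 0}
  have hI : ∀ i ∈ I, i = 0 ∨ |i| = 1 := by
    intro i hi
    simp only [I, Finset.mem_insert, Finset.mem_singleton] at hi
    rcases hi with rfl | rfl | rfl <;> simp
  have hwI : ∀ i ∈ I, ∀ j ∈ I, ∀ l ∈ I, (A ^ i * A ^ j * A ^ l).card ≤ k ^ 3 * A.card := by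
    intro i hi j hj l hl
    rcases hI i hi with rfl | hi <;> rcases hI j hj with rfl | hj <;> rcases hI l hl with rfl | hl <;>
      try simp only [zpow_zero, one_mul, mul_one]
    · simpa using hw0
    · exact hw1 l hl
    · exact hw1 j hj
    · exact hw2 j l hj hl
    · exact hw1 i hi
    · exact hw2 i l hi hl
    · exact hw2 i j hi hj
    · exact hw i j l hi hj hl
  have hSmem : ∀ x ∈ S, ∃ i ∈ I, x ∈ A ^ i := by
    intro x hx
    simp only [hS, Finset.mem_union] at hx
    rcases hx with (hx | hx) | hx
    · exact ⟨1, by simp [I], by simpa using hx⟩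
    · exact ⟨-1, by simp [I], by simpa using hx⟩
    · exact ⟨0, by simp [I], by simpa using hx⟩
  have hcov : S ^ 3 ⊆ (I ×ˢ I ×ˢ I).biUnion fun p => A ^ p.1 * A ^ p.2.1 * A ^ p.2.2 := by
    intro x hx
    rw [pow_three', Finset.mem_mul] at hx
    obtain ⟨y, hy, c, hc, rfl⟩ := hx
    obtain ⟨a, ha, b, hb, rfl⟩ := Finset.mem_mul.1 hy
    obtain ⟨i, hi, hai⟩ := hSmem a ha
    obtain ⟨j, hj, hbj⟩ := hSmem b hb
    obtain ⟨l, hl, hcl⟩ := hSmem c hc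
    refine Finset.mem_biUnion.2 ⟨(i, j, l), ?_, ?_⟩
    · simp [hi, hj, hl]
    · exact Finset.mul_mem_mul (Finset.mul_mem_mul hai hbj) hcl
  have hS3 : (S ^ 3).card ≤ 27 * k ^ 3 * A.card := by
    refine (Finset.card_le_card hcov).trans ?_
    refine (Finset.card_biUnion_le_card_mul _ _ (k ^ 3 * A.card) ?_).trans ?_
    · intro p hp
      simp only [Finset.mem_product] at hp
      exact hwI _ hp.1 _ hp.2.1 _ hp.2.2
    · have : (I ×ˢ I ×ˢ I).card = 27 := by decide
      rw [this, mul_assoc]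
  have hAS : A.card ≤ S.card := Finset.card_le_card fun x hx => by simp [hS, hx]
  have hSA : S.card ≤ 3 * A.card := by
    have h1 := Finset.card_union_le (A ∪ A⁻¹) (1 : Finset G)
    have h2 := Finset.card_union_le A A⁻¹
    have h4 := Finset.card_pos.2 hA
    rw [Finset.card_inv] at h2
    rw [Finset.card_one, ← hS] at h1
    omega
  have hSsymm : S⁻¹ = S := by
    ext x
    simp only [hS, Finset.mem_inv', Finset.mem_union, inv_inv, Finset.mem_one, inv_eq_one]
    tauto
  have hS3' : ((S ^ 3).card : ℝ) ≤ (27 * k ^ 3 : ℝ) * S.card := by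
    exact_mod_cast hS3.trans (Nat.mul_le_mul_left _ hAS)
  have hfin := Finset.small_pow_of_small_tripling (m := m + 3) (by omega) hS3' hSsymm
  have hfin' : (S ^ (m + 3)).card ≤ (27 * k ^ 3) ^ (m + 1) * S.card := by
    exact_mod_cast hfin
  have hmono : S ^ m ⊆ S ^ (m + 3) := Finset.pow_subset_pow_right (by simp [hS]) (by omega)
  calc _ ≤ (S ^ (m + 3)).card := Finset.card_le_card hmono
    _ ≤ _ := hfin'
    _ ≤ (27 * k ^ 3) ^ (m + 1) * (3 * A.card) := Nat.mul_le_mul_left _ hSA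
    _ = _ := by ring


/-- **Bogolyubov–Ruzsa for small tripling.** For all positive integers `k`, `m` there is
`C` such that: if `G` is a group and `A ⊆ G` is nonempty finite with `|A³| ≤ k|A|` and
`⟨A⟩ = Āᵐ` (where `Ā = A ∪ A⁻¹ ∪ {1}`), then there are a normal subgroup `H` of `⟨A⟩` of
index at most `C` and a `(δ, n)`-Bohr neighborhood `B` in `H` with `δ⁻¹, n ≤ C` such that
`B ⊆ (AA⁻¹)² ∩ A²A⁻² ∩ (A⁻¹A)² ∩ A⁻²A²`. Moreover, if `⟨A⟩` is abelian one may take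
`H = ⟨A⟩`. -/
theorem bogolyubov_ruzsa_small_tripling (k m : ℕ) (hk : 0 < k) (hm : 0 < m) :
    ∃ C : ℕ, ∀ (G : Type) [Group G] [DecidableEq G],
      ∀ A : Finset G, A.Nonempty →
      (A ^ 3).card ≤ k * A.card →
      ((Subgroup.closure (A : Set G) : Set G)
        = (((A ∪ A⁻¹ ∪ (1 : Finset G)) ^ m : Finset G) : Set G)) →
      ∃ (H : Subgroup ↥(Subgroup.closure (A : Set G))) (δ : ℝ) (n : ℕ) (B : Set ↥H),
        H.Normal ∧ H.index ≤ C ∧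
        0 < δ ∧ δ⁻¹ ≤ (C : ℝ) ∧ 0 < n ∧ n ≤ C ∧
        IsBohrNbhd δ n B ∧
        (∀ x : ↥H, x ∈ B → ((x : ↥(Subgroup.closure (A : Set G))) : G)
          ∈ ((A * A⁻¹) ^ 2 ∩ (A ^ 2 * A⁻¹ ^ 2) ∩ (A⁻¹ * A) ^ 2 ∩ (A⁻¹ ^ 2 * A ^ 2) :
            Finset G)) ∧
        ((∀ x y : ↥(Subgroup.closure (A : Set G)), x * y = y * x) → H = ⊤) := by
  obtain ⟨C, hC⟩ := aux_main ((27 * k ^ 3) ^ (m + 1) * 3) (by positivity)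
  refine ⟨C, fun G _ _ A hA h3 hgen => ?_⟩
  have hcard := aux_trip k m A hA h3
  have hmem : ∀ x, x ∈ Subgroup.closure (A : Set G) ↔ x ∈ (A ∪ A⁻¹ ∪ (1 : Finset G)) ^ m := by
    intro x
    rw [← SetLike.mem_coe, hgen, Finset.mem_coe]
  let _ : Fintype ↥(Subgroup.closure (A : Set G)) := Fintype.subtype _ (fun x => (hmem x).symm)
  have hc : Fintype.card ↥(Subgroup.closure (A : Set G)) = ((A ∪ A⁻¹ ∪ (1 : Finset G)) ^ m).card :=
    Fintype.card_of_subtype _ (fun x => (hmem x).symm)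
  let A' : Finset ↥(Subgroup.closure (A : Set G)) := Finset.univ.filter fun x => (x : G) ∈ A
  have himg : A'.image (Subgroup.closure (A : Set G)).subtype = A := by
    ext x
    simp only [A', Finset.mem_image, Finset.mem_filter, Finset.mem_univ, true_and]
    constructor
    · rintro ⟨y, hy, rfl⟩; exact hy
    · intro hx
      exact ⟨⟨x, Subgroup.subset_closure hx⟩, hx, rfl⟩
  have hA'c : A'.card = A.card := by
    conv_rhs => rw [← himg]
    rw [Finset.card_image_of_injective _ (Subgroup.subtype_injective _)]
  obtain ⟨p, H, hN, hi, hab, n, hn, hn', τ, hτ⟩ := hC _ A' (by rw [hc, hA'c]; exact hcard)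
  refine ⟨H, (C : ℝ)⁻¹, n, {x : H | dist (0 : Torus n) (Multiplicative.toAdd (τ x)) < (C : ℝ)⁻¹},
    hN, hi, ?_, ?_, hn, hn', ⟨τ, rfl⟩, ?_, hab⟩
  · have : (0 : ℝ) < C := by exact_mod_cast p
    positivity
  · rw [inv_inv]
  intro x hx
  have h := hτ x hx
  rw [Finset.mem_coe] at h
  have h' := Finset.mem_image_of_mem (Subgroup.closure (A : Set G)).subtype h
  simp only [Finset.image_inter _ _ (Subgroup.subtype_injective (Subgroup.closure (A : Set G))), pow_two, Finset.image_mul, Finset.image_inv, himg] at h'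
  simp only [pow_two]
  exact h'
end

section
/- For every positive integer n there is a constant C = C(n) such that the following holds. If G is a group, X ⊆ G is a nonempty finite set, and k ≥ 1 is a real number with |X³| ≤ k|X|, then for all ε₁, …, εₙ ∈ {−1, 1} one has |X^{ε₁} ⋯ X^{εₙ}| ≤ k^C |X|, where X^{ε₁} ⋯ X^{εₙ} denotes the product set of the sets X^{εᵢ} (each being X or X⁻¹). -/
open Pointwise

/-- **Plünnecke–Ruzsa inequalities for small tripling.** For every positive integer `n`
there is `C` such that: if `G` is a group, `X ⊆ G` is nonempty finite, and `k ≥ 1` is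
real with `|X³| ≤ k|X|`, then `|X^{ε₁} ⋯ X^{εₙ}| ≤ k^C |X|` for all signs
`ε₁, …, εₙ ∈ {-1, 1}`. -/
theorem pluennecke_ruzsa_small_tripling (n : ℕ) (hn : 0 < n) :
    ∃ C : ℕ, ∀ (G : Type) [Group G] [DecidableEq G],
      ∀ X : Finset G, X.Nonempty →
      ∀ k : ℝ, 1 ≤ k → ((X ^ 3).card : ℝ) ≤ k * (X.card : ℝ) →
      ∀ ε : Fin n → ℤ, (∀ i, ε i = 1 ∨ ε i = -1) →
      (((List.ofFn fun i => X ^ ε i).prod.card : ℝ)) ≤ k ^ C * (X.card : ℝ) := by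
  refine ⟨3 * n, ?_⟩
  intro G _ _ X hX k hk hX3 ε hε
  have h := Finset.small_alternating_pow_of_small_tripling (m := n + 2) (A := X) (K := k)
    (by omega) hX3 (Fin.cons 1 (Fin.cons 1 ε) : Fin (n + 2) → ℤ) (by
      intro i
      refine Fin.cases (by simp) (fun i => ?_) i
      refine Fin.cases (by simp) (fun i => ?_) i
      simp only [Fin.cons_succ]
      rcases hε i with h | h <;> simp [h])
  rw [← List.ofFn_eq_map, List.ofFn_succ, List.ofFn_succ] at h
  simp only [Fin.cons_zero, Fin.cons_succ, List.prod_cons, zpow_one, Nat.add_sub_cancel] at h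
  refine le_trans ?_ h
  norm_cast
  exact (Finset.card_le_card_mul_left hX).trans (Finset.card_le_card_mul_left hX)
end

section
/- For every positive integer n there is a constant C = C(n) such that the following holds. If G is a group, X ⊆ G is a nonempty finite set, and k ≥ 1 is a real number with |XX⁻¹X| ≤ k|X|, then |(XX⁻¹)ⁿ| ≤ k^C |X|. -/
open Pointwise

/-- **Plünnecke–Ruzsa inequalities for small alternation.** For every positive integer
`n` there is `C` such that: if `G` is a group, `X ⊆ G` is nonempty finite, and `k ≥ 1` is
real with `|XX⁻¹X| ≤ k|X|`, then `|(XX⁻¹)ⁿ| ≤ k^C |X|`. -/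
theorem pluennecke_ruzsa_small_alternation (n : ℕ) (hn : 0 < n) :
    ∃ C : ℕ, ∀ (G : Type) [Group G] [DecidableEq G],
      ∀ X : Finset G, X.Nonempty →
      ∀ k : ℝ, 1 ≤ k → ((X * X⁻¹ * X).card : ℝ) ≤ k * (X.card : ℝ) →
      ((((X * X⁻¹) ^ n).card : ℝ)) ≤ k ^ C * (X.card : ℝ) := by
  refine ⟨2 * n, ?_⟩
  intro G _ _ X hX k hk h
  have hpos : (0 : ℝ) < X.card := by exact_mod_cast hX.card_pos
  have hone : (1 : ℝ) ≤ X.card := by exact_mod_cast hX.card_pos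
  have hk0 : 0 ≤ k := by linarith
  have h' : ((X⁻¹ * X * X⁻¹).card : ℝ) ≤ k * (X.card : ℝ) := by
    rw [← Finset.card_inv]
    simpa [mul_assoc] using h
  have key : ∀ m : ℕ, (((X * X⁻¹) ^ m).card : ℝ) ≤ k ^ (2 * m) * (X.card : ℝ) ∧
      (((X * X⁻¹) ^ m * X).card : ℝ) ≤ k ^ (2 * m + 1) * (X.card : ℝ) := by
    intro m
    induction m with
    | zero =>
      refine ⟨by simpa using hone, ?_⟩
      simp only [pow_zero, one_mul, mul_zero, zero_add, pow_one]
      nlinarith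
    | succ m ih =>
      have a1 : (((X * X⁻¹) ^ (m + 1)).card : ℝ) * X.card ≤
          ((X * X⁻¹) ^ m * X).card * (X * X⁻¹ * X).card := by
        have := Finset.ruzsa_triangle_inequality_mulInv_mul_mul ((X * X⁻¹) ^ m) X (X * X⁻¹)
        rw [show (X * X⁻¹)⁻¹ = X * X⁻¹ by simp, ← pow_succ] at this
        exact_mod_cast this
      have b1 : (((X * X⁻¹) ^ (m + 1)).card : ℝ) ≤ k ^ (2 * (m + 1)) * (X.card : ℝ) := by
        refine le_of_mul_le_mul_right (a1.trans ?_) hpos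
        calc _ ≤ (k ^ (2 * m + 1) * (X.card : ℝ)) * (k * X.card) := by
              gcongr
              exact ih.2
          _ = _ := by ring
      refine ⟨b1, ?_⟩
      have a2 : (((X * X⁻¹) ^ (m + 1) * X).card : ℝ) * X.card ≤
          ((X * X⁻¹) ^ (m + 1)).card * (X⁻¹ * X * X⁻¹).card := by
        have := Finset.ruzsa_triangle_inequality_mulInv_mul_mul
          ((X * X⁻¹) ^ m * X) X⁻¹ (X⁻¹ * X)
        rw [show (X⁻¹ * X)⁻¹ = X⁻¹ * X by simp, Finset.card_inv,
          show (X * X⁻¹) ^ m * X * (X⁻¹ * X) = (X * X⁻¹) ^ (m + 1) * X by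
            simp only [pow_succ, mul_assoc],
          show (X * X⁻¹) ^ m * X * X⁻¹ = (X * X⁻¹) ^ (m + 1) by
            simp only [pow_succ, mul_assoc]] at this
        exact_mod_cast this
      refine le_of_mul_le_mul_right (a2.trans ?_) hpos
      calc _ ≤ (k ^ (2 * (m + 1)) * (X.card : ℝ)) * (k * X.card) := by gcongr
        _ = _ := by ring
  exact (key n).1
end

section
/- If G is a group and X ⊆ G is a nonempty finite set such that |XX⁻¹X| ≤ k|X| for a real number k ≥ 1, then |(XX⁻¹)³| ≤ k⁵|X|. -/
open Pointwise

/-- If `G` is a group and `X ⊆ G` is a nonempty finite set with `|XX⁻¹X| ≤ k|X|` for a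
real `k ≥ 1`, then `|(XX⁻¹)³| ≤ k⁵|X|`. -/
theorem alternation_cube_bound (G : Type*) [Group G] [DecidableEq G]
    (X : Finset G) (hX : X.Nonempty) (k : ℝ) (hk : 1 ≤ k)
    (h : ((X * X⁻¹ * X).card : ℝ) ≤ k * (X.card : ℝ)) :
    ((((X * X⁻¹) ^ 3).card : ℝ)) ≤ k ^ 5 * (X.card : ℝ) := by
  have h1 := Finset.ruzsa_triangle_inequality_mulInv_mul_mul (X * X⁻¹) X (X * X⁻¹)
  have h2 := Finset.ruzsa_triangle_inequality_mulInv_mulInv_mulInv (X * X⁻¹ * X) X (X * X⁻¹ * X)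
  have e1 : (X * X⁻¹) * (X * X⁻¹)⁻¹ = X * X⁻¹ * X * X⁻¹ := by
    simp only [mul_inv_rev, inv_inv, mul_assoc]
  have e2 : (X * X⁻¹ * X) * (X * X⁻¹ * X)⁻¹ = (X * X⁻¹) ^ 3 := by
    simp only [mul_inv_rev, inv_inv, mul_assoc, pow_succ, pow_zero, one_mul]
  rw [e1] at h1
  rw [e2] at h2
  have h1' : ((X * X⁻¹ * X * X⁻¹).card : ℝ) * X.card
      ≤ (X * X⁻¹ * X).card * (X * X⁻¹ * X).card := by exact_mod_cast h1
  have h2' : (((X * X⁻¹) ^ 3).card : ℝ) * X.card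
      ≤ (X * X⁻¹ * X * X⁻¹).card * (X * X⁻¹ * X * X⁻¹).card := by exact_mod_cast h2
  have hx : (0 : ℝ) < X.card := by exact_mod_cast hX.card_pos
  have h3 : ((X * X⁻¹ * X * X⁻¹).card : ℝ) ≤ k ^ 2 * X.card := by
    refine le_of_mul_le_mul_right (h1'.trans ?_) hx
    calc _ ≤ (k * (X.card : ℝ)) * (k * (X.card : ℝ)) := by gcongr
      _ = _ := by ring
  have h4 : (((X * X⁻¹) ^ 3).card : ℝ) ≤ k ^ 4 * X.card := by
    refine le_of_mul_le_mul_right (h2'.trans ?_) hx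
    calc _ ≤ (k ^ 2 * (X.card : ℝ)) * (k ^ 2 * (X.card : ℝ)) := by gcongr
      _ = _ := by ring
  refine h4.trans ?_
  gcongr
  · norm_num
end

section
/- For all positive integers k, m, and n there is a constant C = C(k, m, n) such that the following holds. If G is a group and X ⊆ G is a nonempty finite set with |XX⁻¹X| ≤ k|X|, then there is a finite symmetric set Y ⊆ G such that Yⁿ ⊆ (XX⁻¹)² and (XX⁻¹)ᵐ is covered by at most C translates aY with a ∈ (XX⁻¹)ᵐ. -/
open Pointwise

lemma scs_growth (k m : ℕ) {G : Type} [Group G] [DecidableEq G] (X : Finset G)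
    (hX : X.Nonempty) (h : (X * X⁻¹ * X).card ≤ k * X.card) :
    ((X * X⁻¹) ^ (m + 1) * X).card ≤ (k ^ 3) ^ m * k * X.card := by
  have hpos : 0 < X.card := hX.card_pos
  have h' : (X⁻¹ * X * X⁻¹).card ≤ k * X.card := by
    have : (X⁻¹ * X * X⁻¹) = (X * X⁻¹ * X)⁻¹ := by simp [mul_inv_rev, mul_assoc]
    rw [this, Finset.card_inv]; exact h
  have h1 : (X⁻¹ * X * (X⁻¹ * X)).card ≤ k ^ 2 * X.card := by
    have t := Finset.ruzsa_triangle_inequality_mul_mul_invMul (X⁻¹ * X) X⁻¹ (X⁻¹ * X)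
    rw [mul_inv_rev, inv_inv, Finset.card_inv] at t
    have t2 := t.trans (Nat.mul_le_mul h' h')
    refine Nat.le_of_mul_le_mul_right (t2.trans (le_of_eq (by ring))) hpos
  have h2 : (X * X⁻¹ * (X * X⁻¹) * X).card ≤ k ^ 3 * X.card := by
    have t := Finset.ruzsa_triangle_inequality_mul_mul_invMul (X * X⁻¹) X (X * X⁻¹ * X)
    have e : (X * X⁻¹ * X)⁻¹ * X = X⁻¹ * X * (X⁻¹ * X) := by simp [mul_inv_rev, mul_assoc]
    rw [e] at t
    have t2 := t.trans (Nat.mul_le_mul h h1)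
    rw [mul_assoc (X * X⁻¹)]
    refine Nat.le_of_mul_le_mul_right (t2.trans (le_of_eq (by ring))) hpos
  obtain ⟨F, -, hF, hFc⟩ := Finset.ruzsa_covering_mul (A := X * X⁻¹ * (X * X⁻¹)) (B := X)
    (K := (k^3 : ℕ)) hX (by exact_mod_cast h2)
  have hF : F.card ≤ k ^ 3 := by exact_mod_cast hF
  rw [div_eq_mul_inv] at hFc
  induction m with
  | zero => simpa using h
  | succ m ih =>
    have : (X * X⁻¹) ^ (m + 1 + 1) * X ⊆ F * ((X * X⁻¹) ^ (m + 1) * X) := by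
      calc (X * X⁻¹) ^ (m + 1 + 1) * X = (X * X⁻¹ * (X * X⁻¹)) * ((X * X⁻¹) ^ m * X) := by
            rw [pow_succ', pow_succ']; simp only [mul_assoc]
        _ ⊆ (F * (X * X⁻¹)) * ((X * X⁻¹) ^ m * X) := Finset.mul_subset_mul_right hFc
        _ = _ := by rw [pow_succ']; simp only [mul_assoc]
    calc _ ≤ _ := Finset.card_le_card this
      _ ≤ F.card * ((X * X⁻¹) ^ (m + 1) * X).card := Finset.card_mul_le
      _ ≤ k ^ 3 * ((k ^ 3) ^ m * k * X.card) := Nat.mul_le_mul hF ih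
      _ = _ := by ring

lemma scs_packing (q K M : ℕ) (hM : 2 * q * K < M) {G : Type} [Group G] [DecidableEq G]
    (A X B Y F : Finset G) (hX : X.Nonempty) (hA : (A * X).card ≤ K * X.card) (hB : B ⊆ X)
    (hq : X.card ≤ q * B.card)
    (hY : ∀ g, g ∉ Y → 2 * q * M * (B ∩ g • B).card < X.card)
    (hFA : F ⊆ A) (hF : ∀ f ∈ F, ∀ f' ∈ F, f ≠ f' → f⁻¹ * f' ∉ Y) : F.card < M := by
  by_contra hc
  obtain ⟨F, hF', hFM⟩ := Finset.exists_subset_card_eq (not_lt.mp hc)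
  replace hF : ∀ f ∈ F, ∀ f' ∈ F, f ≠ f' → f⁻¹ * f' ∉ Y :=
    fun f hf f' hf' => hF f (hF' hf) f' (hF' hf')
  replace hFA := hF'.trans hFA
  have hpos : 0 < X.card := hX.card_pos
  let E : G → Finset G := fun f => (f • B) \ (F.erase f).biUnion (fun f' => f' • B)
  have hE : ∀ f ∈ F, X.card ≤ 2 * q * (E f).card := by
    intro f hf
    have a1 : (f • B).card ≤ (E f).card +
        ((f • B) ∩ (F.erase f).biUnion (fun f' => f' • B)).card := by
      rw [Finset.card_sdiff_add_card_inter]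
    have a2 : ((f • B) ∩ (F.erase f).biUnion (fun f' => f' • B)).card
        ≤ ∑ f' ∈ F.erase f, (f • B ∩ f' • B).card := by
      rw [Finset.inter_biUnion]
      exact Finset.card_biUnion_le
    have a3 : 2 * q * M * ∑ f' ∈ F.erase f, (f • B ∩ f' • B).card ≤ M * X.card := by
      rw [Finset.mul_sum]
      calc _ ≤ ∑ f' ∈ F.erase f, X.card := by
            refine Finset.sum_le_sum fun f' hf' => ?_
            have hne := Finset.ne_of_mem_erase hf'
            have := hY _ (hF f hf f' (Finset.mem_of_mem_erase hf') hne.symm)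
            have e : (f • B ∩ f' • B) = f • (B ∩ (f⁻¹ * f') • B) := by
              rw [Finset.smul_finset_inter, smul_smul]; simp
            rw [e, Finset.card_smul_finset]
            exact this.le
        _ = (F.erase f).card * X.card := by simp
        _ ≤ _ := Nat.mul_le_mul_right _ (by rw [← hFM]; exact Finset.card_erase_le)
    have a4 : 2 * q * ∑ f' ∈ F.erase f, (f • B ∩ f' • B).card ≤ X.card := by
      refine le_of_mul_le_mul_left (a := M) ?_ (by omega)
      refine le_trans (le_of_eq (by ring)) a3
    rw [Finset.card_smul_finset] at a1
    have a5 := Nat.mul_le_mul_left (2 * q) (a1.trans (Nat.add_le_add_left a2 _))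
    nlinarith
  have hdis : (F.biUnion E).card = ∑ f ∈ F, (E f).card := by
    refine Finset.card_biUnion fun f hf f' hf' hne => ?_
    refine Finset.disjoint_left.mpr ?_
    intro x hx hx'
    simp only [E, Finset.mem_sdiff, Finset.mem_biUnion, Finset.mem_erase] at hx hx'
    exact hx.2 ⟨f', ⟨hne.symm, hf'⟩, hx'.1⟩
  have hsub : F.biUnion E ⊆ A * X := by
    intro x hx
    simp only [E, Finset.mem_sdiff, Finset.mem_biUnion] at hx
    obtain ⟨f, hf, hx, -⟩ := hx
    obtain ⟨b, hb, rfl⟩ := Finset.mem_smul_finset.mp hx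
    exact Finset.mul_mem_mul (hFA hf) (hB hb)
  have h1 := (Finset.card_le_card hsub).trans hA
  have h2 : M * X.card ≤ 2 * q * (F.biUnion E).card := by
    rw [hdis, Finset.mul_sum, ← hFM, ← smul_eq_mul, ← Finset.sum_const]
    exact Finset.sum_le_sum hE
  have h3 : M * X.card ≤ 2 * q * K * X.card :=
    h2.trans ((Nat.mul_le_mul_left _ h1).trans (le_of_eq (by ring)))
  have := Nat.le_of_mul_le_mul_right h3 hpos
  omega

lemma scs_cover (q K M : ℕ) (hM : 2 * q * K < M) {G : Type} [Group G] [DecidableEq G]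
    (A X B Y : Finset G) (hX : X.Nonempty) (hA : (A * X).card ≤ K * X.card) (hB : B ⊆ X)
    (hq : X.card ≤ q * B.card) (h1 : (1 : G) ∈ Y) (hs : Y⁻¹ = Y)
    (hY : ∀ g, g ∉ Y → 2 * q * M * (B ∩ g • B).card < X.card) :
    ∃ F : Finset G, F ⊆ A ∧ F.card ≤ M ∧ A ⊆ F * Y := by
  classical
  let T := A.powerset.filter (fun F => ∀ f ∈ F, ∀ f' ∈ F, f ≠ f' → f⁻¹ * f' ∉ Y)
  have hT : T.Nonempty := ⟨∅, by simp [T]⟩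
  obtain ⟨F, hFT, hmax⟩ := Finset.exists_max_image T Finset.card hT
  have hFT' := hFT
  simp only [T, Finset.mem_filter, Finset.mem_powerset] at hFT
  refine ⟨F, hFT.1, (scs_packing q K M hM A X B Y F hX hA hB hq hY hFT.1 hFT.2).le, ?_⟩
  have hinv : ∀ g, g ∈ Y → g⁻¹ ∈ Y := fun g hg => by rw [← hs]; exact Finset.inv_mem_inv hg
  intro a ha
  by_contra hno
  have hall : ∀ f ∈ F, f⁻¹ * a ∉ Y := by
    intro f hf hfa
    exact hno (Finset.mem_mul.mpr ⟨f, hf, _, hfa, by simp⟩)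
  have haF : a ∉ F := fun h => hall a h (by simpa using h1)
  have : insert a F ∈ T := by
    simp only [T, Finset.mem_filter, Finset.mem_powerset]
    refine ⟨Finset.insert_subset ha hFT.1, ?_⟩
    intro f hf f' hf' hne
    rw [Finset.mem_insert] at hf hf'
    rcases hf with rfl | hf <;> rcases hf' with rfl | hf'
    · exact absurd rfl hne
    · intro hc
      exact hall f' hf' (by simpa using hinv _ hc)
    · exact hall f hf
    · exact hFT.2 f hf f' hf' hne
  have := hmax _ this
  rw [Finset.card_insert_of_notMem haF] at this
  omega

lemma scs_Y (n : ℕ) (hn : 0 < n) {G : Type} [Group G] [DecidableEq G] (D : Finset G)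
    (hD : D.Nonempty) :
    ∃ Y : Finset G, (1 : G) ∈ Y ∧ Y⁻¹ = Y ∧ Y ^ n ⊆ D * D⁻¹ ∧
      ∀ g, g ∉ Y → D.card ≤ n * (D \ g • D).card := by
  have key : ∀ g : G, (D ∩ g • D).Nonempty → g ∈ D * D⁻¹ := by
    rintro g ⟨x, hx⟩
    rw [Finset.mem_inter] at hx
    obtain ⟨d, hd, rfl⟩ := Finset.mem_smul_finset.mp hx.2
    exact Finset.mem_mul.mpr ⟨g • d, hx.1, d⁻¹, Finset.inv_mem_inv hd, by simp⟩
  have key2 : ∀ g : G, (D \ g • D).card < D.card → g ∈ D * D⁻¹ := by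
    intro g hg
    apply key
    rw [Finset.nonempty_iff_ne_empty]
    intro he
    have := Finset.card_sdiff_add_card_inter D (g • D)
    rw [he] at this
    simp at this
    omega
  have hpos := hD.card_pos
  let Y := (D * D⁻¹).filter (fun g => n * (D \ g • D).card < D.card)
  have hmem : ∀ g, g ∈ Y ↔ n * (D \ g • D).card < D.card := by
    intro g
    simp only [Y, Finset.mem_filter, and_iff_right_iff_imp]
    intro h
    apply key2
    nlinarith
  have hsymm : ∀ g : G, (D \ g⁻¹ • D).card = (D \ g • D).card := by
    intro g
    have e1 := Finset.card_sdiff_add_card_inter D (g⁻¹ • D)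
    have e2 := Finset.card_sdiff_add_card_inter D (g • D)
    have e3 : (D ∩ g⁻¹ • D).card = (D ∩ g • D).card := by
      rw [← Finset.card_smul_finset g (D ∩ g⁻¹ • D), Finset.smul_finset_inter, smul_smul]
      simp [Finset.inter_comm]
    omega
  refine ⟨Y, ?_, ?_, ?_, ?_⟩
  · rw [hmem]; simpa using hpos
  · ext g
    rw [Finset.mem_inv', hmem, hmem, hsymm]
  · have hstep : ∀ i, ∀ g ∈ Y ^ i, n * (D \ g • D).card ≤ i * (D.card - 1) := by
      intro i
      induction i with
      | zero => intro g hg; simp at hg; subst hg; simp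
      | succ i ih =>
        intro g hg
        rw [pow_succ] at hg
        obtain ⟨a, ha, b, hb, rfl⟩ := Finset.mem_mul.mp hg
        have h1 := ih a ha
        have h2 := (hmem b).mp hb
        have h3 : D \ (a * b) • D ⊆ (D \ a • D) ∪ a • (D \ b • D) := by
          rw [Finset.smul_finset_sdiff, smul_smul]
          intro x hx
          simp only [Finset.mem_union, Finset.mem_sdiff] at hx ⊢
          tauto
        have h4 := (Finset.card_le_card h3).trans (Finset.card_union_le _ _)
        rw [Finset.card_smul_finset] at h4
        have h5 := Nat.mul_le_mul_left n h4
        have h6 : n * (D \ b • D).card ≤ D.card - 1 := by omega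
        rw [mul_add] at h5
        rw [add_mul]
        omega
    intro g hg
    apply key2
    have := Nat.le_of_mul_le_mul_left (hstep n g hg) hn
    omega
  · intro g hg
    rw [hmem] at hg
    exact not_lt.mp hg

lemma scs_core (n m K : ℕ) (hn : 0 < n) (j : ℕ) : ∀ (r : ℝ) (q : ℕ),
    (1 - 1 / (n : ℝ)) ^ j * r < 1 →
    ∃ C : ℕ, ∀ (G : Type) [Group G] [DecidableEq G],
      ∀ X : Finset G, X.Nonempty → ((X * X⁻¹) ^ m * X).card ≤ K * X.card →
      ∀ B : Finset G, B ⊆ X → X.card ≤ q * B.card → ((B * X⁻¹).card : ℝ) ≤ r * X.card →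
      ∃ Y : Finset G, (1 : G) ∈ Y ∧ Y⁻¹ = Y ∧
        Y ^ n ⊆ (X * X⁻¹) ^ 2 ∧
        ∃ F : Finset G, F ⊆ (X * X⁻¹) ^ m ∧ F.card ≤ C ∧
          (X * X⁻¹) ^ m ⊆ F * Y := by
  have hBne : ∀ (G : Type) [Group G] [DecidableEq G] (X B : Finset G) (q : ℕ), X.Nonempty →
      X.card ≤ q * B.card → B.Nonempty := by
    intro G _ _ X B q hX h
    rw [Finset.nonempty_iff_ne_empty]
    rintro rfl
    have := hX.card_pos
    simp at h
    simp [h] at this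
  induction j with
  | zero =>
    intro r q hr
    refine ⟨0, ?_⟩
    intro G _ _ X hX _ B hB hq hD
    exfalso
    have h1 : X.card ≤ (B * X⁻¹).card := by
      rw [← Finset.card_inv X]
      exact Finset.card_le_card_mul_left (hBne G X B q hX hq)
    have h1' : (X.card : ℝ) ≤ (B * X⁻¹).card := by exact_mod_cast h1
    have : (0 : ℝ) < X.card := by exact_mod_cast hX.card_pos
    simp at hr
    nlinarith
  | succ j ih =>
    intro r q hr
    set M := 2 * q * K + 1 with hM
    obtain ⟨C, hC⟩ := ih ((1 - 1 / (n : ℝ)) * r) (2 * q * M) (by rw [pow_succ] at hr; linarith)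
    refine ⟨max M C, ?_⟩
    intro G _ _ X hX hA B hB hq hD
    have hBn := hBne G X B q hX hq
    obtain ⟨Y, hY1, hY2, hY3, hY4⟩ := scs_Y n hn (B * X⁻¹) (hBn.mul hX.inv)
    by_cases hg : ∀ g, g ∉ Y → 2 * q * M * (B ∩ g • B).card < X.card
    · obtain ⟨F, hF1, hF2, hF3⟩ := scs_cover q K M (by omega) ((X * X⁻¹) ^ m) X B Y hX hA hB hq
        hY1 hY2 hg
      refine ⟨Y, hY1, hY2, hY3.trans ?_, F, hF1, hF2.trans (le_max_left _ _), hF3⟩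
      rw [pow_two, mul_inv_rev, inv_inv]
      refine Finset.mul_subset_mul (Finset.mul_subset_mul_right hB)
        (Finset.mul_subset_mul_left (Finset.inv_subset_inv hB))
    · push Not at hg
      obtain ⟨g, hgY, hgX⟩ := hg
      have h4 := hY4 g hgY
      have hsub : (B ∩ g • B) * X⁻¹ ⊆ (B * X⁻¹) ∩ g • (B * X⁻¹) := by
        apply Finset.subset_inter
        · exact Finset.mul_subset_mul_right Finset.inter_subset_left
        · rw [← smul_mul_assoc]
          exact Finset.mul_subset_mul_right Finset.inter_subset_right
      have h5 := Finset.card_le_card hsub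
      have h6 := Finset.card_sdiff_add_card_inter (B * X⁻¹) (g • (B * X⁻¹))
      have hn' : (0 : ℝ) < n := by exact_mod_cast hn
      obtain ⟨Y, hY1, hY2, hY3, F, hF1, hF2, hF3⟩ := hC G X hX hA (B ∩ g • B)
        (Finset.inter_subset_left.trans hB) hgX (by
          have h4' : ((B * X⁻¹).card : ℝ) ≤ n * ((B * X⁻¹) \ g • (B * X⁻¹)).card := by
            exact_mod_cast h4
          have h5' : (((B ∩ g • B) * X⁻¹).card : ℝ) ≤ ((B * X⁻¹) ∩ g • (B * X⁻¹)).card := by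
            exact_mod_cast h5
          have h6' : (((B * X⁻¹) \ g • (B * X⁻¹)).card : ℝ) + ((B * X⁻¹) ∩ g • (B * X⁻¹)).card
              = (B * X⁻¹).card := by exact_mod_cast h6
          have h7 : ((B * X⁻¹).card : ℝ) / n ≤ ((B * X⁻¹) \ g • (B * X⁻¹)).card := by
            rw [div_le_iff₀ hn']; linarith
          have h8 : (0 : ℝ) ≤ 1 - 1 / (n : ℝ) := by
            have : (1 : ℝ) ≤ n := by exact_mod_cast hn
            have : 1 / (n : ℝ) ≤ 1 := by rw [div_le_one hn']; exact this
            linarith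
          calc (((B ∩ g • B) * X⁻¹).card : ℝ)
              ≤ (B * X⁻¹).card - ((B * X⁻¹).card : ℝ) / n := by linarith
            _ = (1 - 1 / (n : ℝ)) * (B * X⁻¹).card := by ring
            _ ≤ (1 - 1 / (n : ℝ)) * (r * X.card) := mul_le_mul_of_nonneg_left hD h8
            _ = _ := by ring)
      exact ⟨Y, hY1, hY2, hY3, F, hF1, hF2.trans (le_max_right _ _), hF3⟩



/-- **Sanders–Croot–Sisask for small alternation.** For all positive integers `k`, `m`,
`n` there is `C` such that: if `G` is a group and `X ⊆ G` is nonempty finite with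
`|XX⁻¹X| ≤ k|X|`, then there is a finite symmetric `Y ⊆ G` with `Yⁿ ⊆ (XX⁻¹)²` such that
`(XX⁻¹)ᵐ` is covered by at most `C` translates `aY` with `a ∈ (XX⁻¹)ᵐ`. -/
theorem sanders_croot_sisask_alternation (k m n : ℕ) (hk : 0 < k) (hm : 0 < m)
    (hn : 0 < n) :
    ∃ C : ℕ, ∀ (G : Type) [Group G] [DecidableEq G],
      ∀ X : Finset G, X.Nonempty →
      (X * X⁻¹ * X).card ≤ k * X.card →
      ∃ Y : Finset G, (1 : G) ∈ Y ∧ Y⁻¹ = Y ∧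
        Y ^ n ⊆ (X * X⁻¹) ^ 2 ∧
        ∃ F : Finset G, F ⊆ (X * X⁻¹) ^ m ∧ F.card ≤ C ∧
          (X * X⁻¹) ^ m ⊆ F * Y := by
  have hn' : (1 : ℝ) ≤ n := by exact_mod_cast hn
  have hk' : (0 : ℝ) < k := by exact_mod_cast hk
  have hpos : (0 : ℝ) < n := by linarith
  have h0 : (0 : ℝ) ≤ 1 - 1 / (n : ℝ) := by
    have : 1 / (n : ℝ) ≤ 1 := by rw [div_le_one hpos]; exact hn'
    linarith
  have h1 : 1 - 1 / (n : ℝ) < 1 := by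
    have : 0 < 1 / (n : ℝ) := by positivity
    linarith
  obtain ⟨j, hj⟩ := exists_pow_lt_of_lt_one (show (0 : ℝ) < 1 / k by positivity) h1
  rw [lt_div_iff₀ hk'] at hj
  obtain ⟨m, rfl⟩ : ∃ m', m = m' + 1 := ⟨m - 1, by omega⟩
  obtain ⟨C, hC⟩ := scs_core n (m + 1) ((k ^ 3) ^ m * k) hn j k 1 hj
  refine ⟨C, ?_⟩
  intro G _ _ X hX h
  refine hC G X hX (scs_growth k m X hX h) X (Finset.Subset.refl X) (by simp) ?_
  have : (X * X⁻¹).card ≤ (X * X⁻¹ * X).card := Finset.card_le_card_mul_right hX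
  exact_mod_cast this.trans h
end

section
/- For all positive integers k, m, and n there is a constant C = C(k, m, n) such that the following holds. If G is a group and X ⊆ G is a nonempty finite set with |X³| ≤ k|X|, then there is a finite symmetric set Y ⊆ G such that Yⁿ ⊆ (XX⁻¹)² ∩ X²X⁻² ∩ (X⁻¹X)² ∩ X⁻²X² and X̄ᵐ is covered by at most C translates aY with a ∈ X̄ᵐ, where X̄ = X ∪ X⁻¹ ∪ {1}. -/
open Pointwise

namespace SCS
open Finset

lemma sep_card {G : Type} [Group G] [DecidableEq G] (A : Finset G) (N : ℕ) (F : Finset G)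
    (hF : ∀ z ∈ F, ∀ w ∈ F, z ≠ w → 2 * N * ((z • A) ∩ (w • A)).card ≤ A.card) :
    2 * N * F.card * A.card ≤ 2 * N * (F * A).card + F.card ^ 2 * A.card := by
  induction F using Finset.induction_on with
  | empty => simp
  | insert z F hz ih =>
    have ih' := ih (fun a ha b hb => hF a (mem_insert_of_mem ha) b (mem_insert_of_mem hb))
    have e : insert z F * A = (z • A) ∪ F * A := by
      rw [insert_eq, union_mul, ← smul_eq_mul ({z} : Finset G) A, singleton_smul]
    have h1 := card_union_add_card_inter (z • A) (F * A)
    rw [card_smul_finset] at h1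
    have h2 : (z • A) ∩ (F * A) ⊆ F.biUnion (fun w => (z • A) ∩ (w • A)) := by
      intro x hx
      rw [mem_inter] at hx
      obtain ⟨w, hw, a, ha, rfl⟩ := mem_mul.1 hx.2
      rw [mem_biUnion]
      exact ⟨w, hw, mem_inter.2 ⟨hx.1, smul_mem_smul_finset ha⟩⟩
    have h3 : 2 * N * ((z • A) ∩ (F * A)).card ≤ F.card * A.card := by
      calc _ ≤ 2 * N * ∑ w ∈ F, ((z • A) ∩ (w • A)).card :=
            Nat.mul_le_mul_left _ ((card_le_card h2).trans card_biUnion_le)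
        _ = ∑ w ∈ F, 2 * N * ((z • A) ∩ (w • A)).card := mul_sum _ _ _
        _ ≤ ∑ w ∈ F, A.card := by
            refine sum_le_sum fun w hw => hF _ (mem_insert_self _ _) _ (mem_insert_of_mem hw) ?_
            rintro rfl; exact hz hw
        _ = _ := by simp
    rw [e, card_insert_of_notMem hz]
    nlinarith

lemma cover {G : Type} [Group G] [DecidableEq G] (A Z : Finset G) (hA : A.Nonempty) (M : ℕ)
    (hZ : (Z * A).card ≤ M * A.card) :
    ∃ F ⊆ Z, F.card ≤ 2 * M + 1 ∧ ∀ z ∈ Z, ∃ w ∈ F,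
      A.card ≤ 2 * (2 * M + 1) * ((w • A) ∩ (z • A)).card := by
  classical
  set N := 2 * M + 1 with hN
  have hpos : 0 < A.card := hA.card_pos
  let P : Finset G → Prop := fun F => ∀ z ∈ F, ∀ w ∈ F, z ≠ w →
    2 * N * ((z • A) ∩ (w • A)).card ≤ A.card
  have hne : (Z.powerset.filter P).Nonempty := ⟨∅, by simp [P]⟩
  obtain ⟨F, hF, hmax⟩ := exists_max_image _ Finset.card hne
  rw [mem_filter, mem_powerset] at hF
  refine ⟨F, hF.1, ?_, ?_⟩
  · by_contra hc
    obtain ⟨F', hF', hcard⟩ := exists_subset_card_eq (show N ≤ F.card by omega)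
    have := sep_card A N F' (fun z hz w hw => hF.2 z (hF' hz) w (hF' hw))
    have h2 : (F' * A).card ≤ M * A.card :=
      (card_le_card (mul_subset_mul_right (hF'.trans hF.1))).trans hZ
    rw [hcard] at this
    have h3 : 2 * N * N * A.card ≤ (2 * N * M + N ^ 2) * A.card := by nlinarith
    have h4 := Nat.le_of_mul_le_mul_right h3 hpos
    nlinarith
  · intro z hz
    by_contra! hc
    have hzF : z ∉ F := by
      intro h
      have := hc z h
      rw [inter_self, card_smul_finset] at this
      nlinarith
    have := hmax (insert z F) (by
      rw [mem_filter, mem_powerset]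
      refine ⟨insert_subset hz hF.1, ?_⟩
      intro a ha b hb hab
      rw [mem_insert] at ha hb
      rcases ha with rfl | ha <;> rcases hb with rfl | hb
      · exact absurd rfl hab
      · rw [inter_comm]; exact (hc b hb).le
      · exact (hc a ha).le
      · exact hF.2 a ha b hb hab)
    rw [card_insert_of_notMem hzF] at this
    omega

lemma diff_pow {G : Type} [Group G] [DecidableEq G] (D S : Finset G) (n : ℕ)
    (hS : ∀ s ∈ S, n * (D \ (s • D)).card < D.card) (j : ℕ) (hj : 0 < j) :
    ∀ s ∈ S ^ j, n * (D \ (s • D)).card < j * D.card := by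
  induction j, hj using Nat.le_induction with
  | base => simpa using hS
  | succ j hj ih =>
    intro s hs
    rw [pow_succ] at hs
    obtain ⟨a, ha, b, hb, rfl⟩ := mem_mul.1 hs
    have h1 := ih a ha
    have h2 := hS b hb
    have h3 : D \ ((a * b) • D) ⊆ (D \ (a • D)) ∪ a • (D \ (b • D)) := by
      rw [smul_finset_sdiff, smul_smul]
      intro x hx
      simp only [mem_union, mem_sdiff] at hx ⊢
      tauto
    have h4 := (card_le_card h3).trans (card_union_le _ _)
    rw [card_smul_finset] at h4
    nlinarith

/-- sequence of density parameters -/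
def q (L : ℕ) : ℕ → ℕ
  | 0 => 1
  | j + 1 => 2 * (2 * (L * q L j) + 1) * q L j

lemma exists_good {G : Type} [Group G] [DecidableEq G] (A B : Finset G) (L n K J : ℕ)
    (hA : A.Nonempty) (hB : B.Nonempty) (hAB : (A * B).card ≤ K * B.card)
    (hJ : (n - 1) ^ J * K < n ^ J) :
    ∃ j < J, ∃ A' ⊆ A, A.card ≤ q L j * A'.card ∧
      ∀ s : G, A.card ≤ q L (j + 1) * (A' ∩ (s • A')).card →
        (n - 1) * (A' * B).card < n * ((A' ∩ (s • A')) * B).card := by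
  by_contra! hc
  have key : ∀ j ≤ J, ∃ A' ⊆ A, A.card ≤ q L j * A'.card ∧
      n ^ j * (A' * B).card ≤ (n - 1) ^ j * (A * B).card := by
    intro j
    induction j with
    | zero => intro _; exact ⟨A, Subset.rfl, by simp [q], by simp⟩
    | succ j ih =>
      intro hj
      obtain ⟨A', hA', h1, h2⟩ := ih (by omega)
      obtain ⟨s, h3, h4⟩ := hc j (by omega) A' hA' h1
      refine ⟨_, inter_subset_left.trans hA', h3, ?_⟩
      calc _ = n ^ j * (n * ((A' ∩ (s • A')) * B).card) := by ring
        _ ≤ n ^ j * ((n - 1) * (A' * B).card) := Nat.mul_le_mul_left _ h4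
        _ = (n - 1) * (n ^ j * (A' * B).card) := by ring
        _ ≤ (n - 1) * ((n - 1) ^ j * (A * B).card) := Nat.mul_le_mul_left _ h2
        _ = _ := by ring
  obtain ⟨A', hA', h1, h2⟩ := key J le_rfl
  have hne : A'.Nonempty := by
    rw [nonempty_iff_ne_empty]; rintro rfl
    have := hA.card_pos
    simp at h1; simp [h1] at this
  have h3 : B.card ≤ (A' * B).card := card_le_card_mul_left hne
  have hp := hB.card_pos
  have : n ^ J * B.card ≤ ((n - 1) ^ J * K) * B.card := by
    calc _ ≤ n ^ J * (A' * B).card := Nat.mul_le_mul_left _ h3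
      _ ≤ _ := h2
      _ ≤ (n - 1) ^ J * (K * B.card) := Nat.mul_le_mul_left _ hAB
      _ = _ := by ring
  have := Nat.le_of_mul_le_mul_right this hp
  omega

lemma exists_J (n K : ℕ) (hn : 0 < n) : ∃ J : ℕ, (n - 1) ^ J * K < n ^ J := by
  have hn' : (0 : ℝ) < n := by exact_mod_cast hn
  have h1 : ((n - 1 : ℕ) : ℝ) / n < 1 := by
    rw [div_lt_one hn']; exact_mod_cast (by omega)
  obtain ⟨J, hJ⟩ := exists_pow_lt_of_lt_one (show (0 : ℝ) < 1 / (K + 1) by positivity) h1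
  refine ⟨J, ?_⟩
  rw [div_pow, div_lt_div_iff₀ (by positivity) (by positivity)] at hJ
  have : ((n - 1) ^ J * (K + 1) : ℕ) < n ^ J := by
    have : (((n - 1) ^ J * (K + 1) : ℕ) : ℝ) < ((n ^ J : ℕ) : ℝ) := by
      push_cast at hJ ⊢; linarith
    exact_mod_cast this
  nlinarith [Nat.zero_le ((n - 1) ^ J)]

lemma single (K L n : ℕ) (hn : 0 < n) : ∃ C : ℕ, ∀ (G : Type) [Group G] [DecidableEq G],
    ∀ A B Z : Finset G, A.Nonempty → B.Nonempty → (A * B).card ≤ K * B.card →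
      (Z * A).card ≤ L * A.card →
      ∃ Y : Finset G, (1 : G) ∈ Y ∧ Y⁻¹ = Y ∧ Y ^ n ⊆ (A * B) * (A * B)⁻¹ ∧
        ∃ F ⊆ Z, F.card ≤ C ∧ Z ⊆ F * Y := by
  obtain ⟨J, hJ⟩ := exists_J n K hn
  refine ⟨∑ j ∈ range J, (2 * (L * q L j) + 1), ?_⟩
  intro G _ _ A B Z hA hB hAB hZ
  obtain ⟨j, hj, A', hA', h1, hgood⟩ := exists_good A B L n K J hA hB hAB hJ
  have hp := hA.card_pos
  have hne : A'.Nonempty := by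
    rw [nonempty_iff_ne_empty]; rintro rfl
    simp at h1; simp [h1] at hp
  have hq : A.card ≤ q L (j + 1) * A'.card := by
    simp only [q]
    calc _ ≤ 1 * (q L j * A'.card) := by simpa using h1
      _ ≤ (2 * (2 * (L * q L j) + 1)) * (q L j * A'.card) := Nat.mul_le_mul_right _ (by omega)
      _ = _ := by ring
  have hqp : 0 < q L (j + 1) := by
    rcases Nat.eq_zero_or_pos (q L (j+1)) with h | h
    · rw [h] at hq; omega
    · exact h
  have hinv : ∀ s : G, (A' ∩ (s⁻¹ • A')).card = (A' ∩ (s • A')).card := by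
    intro s
    rw [← card_smul_finset s (A' ∩ (s⁻¹ • A')), smul_finset_inter, smul_inv_smul, inter_comm]
  let Y : Finset G := (A' * A'⁻¹).filter fun s => A.card ≤ q L (j + 1) * (A' ∩ (s • A')).card
  have hY : ∀ s, s ∈ Y ↔ A.card ≤ q L (j + 1) * (A' ∩ (s • A')).card := by
    intro s
    simp only [Y, mem_filter, and_iff_right_iff_imp]
    intro h
    have : (A' ∩ (s • A')).Nonempty := by
      rw [nonempty_iff_ne_empty]; intro h'
      rw [h'] at h; simp at h; simp [h] at hp
    obtain ⟨x, hx⟩ := this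
    rw [mem_inter, mem_smul_finset] at hx
    obtain ⟨hx, y, hy, rfl⟩ := hx
    exact mem_mul.2 ⟨_, hx, y⁻¹, inv_mem_inv hy, by simp⟩
  refine ⟨Y, (hY 1).2 (by simpa using hq), ?_, ?_, ?_⟩
  · ext s; rw [mem_inv', hY, hY, hinv]
  · have hD : ∀ s ∈ Y, n * ((A' * B) \ (s • (A' * B))).card < (A' * B).card := by
      intro s hs
      have h2 := hgood s ((hY s).1 hs)
      have h3 : (A' ∩ (s • A')) * B ⊆ (A' * B) ∩ (s • (A' * B)) := by
        refine subset_inter (mul_subset_mul_right inter_subset_left) ?_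
        rw [← smul_mul_assoc]
        exact mul_subset_mul_right inter_subset_right
      have h4 := card_le_card h3
      have h5 := card_sdiff_add_card_inter (A' * B) (s • (A' * B))
      obtain ⟨n, rfl⟩ : ∃ n', n = n' + 1 := ⟨n - 1, by omega⟩
      simp only [Nat.add_sub_cancel] at h2
      nlinarith
    intro s hs
    have h2 := diff_pow _ Y n hD n hn s hs
    have h3 := Nat.lt_of_mul_lt_mul_left h2
    have h5 := card_sdiff_add_card_inter (A' * B) (s • (A' * B))
    have h6 : ((A' * B) ∩ (s • (A' * B))).Nonempty := by
      rw [← card_pos]; omega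
    obtain ⟨x, hx⟩ := h6
    rw [mem_inter, mem_smul_finset] at hx
    obtain ⟨hx, y, hy, rfl⟩ := hx
    have hsub : A' * B ⊆ A * B := mul_subset_mul_right hA'
    exact mem_mul.2 ⟨_, hsub hx, y⁻¹, inv_mem_inv (hsub hy), by simp⟩
  · obtain ⟨F, hFZ, hFc, hF⟩ := cover A' Z hne (L * q L j) (by
      calc (Z * A').card ≤ (Z * A).card := card_le_card (mul_subset_mul_left hA')
        _ ≤ L * A.card := hZ
        _ ≤ L * (q L j * A'.card) := Nat.mul_le_mul_left _ h1
        _ = _ := by ring)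
    refine ⟨F, hFZ, hFc.trans ?_, ?_⟩
    · exact single_le_sum (f := fun j => 2 * (L * q L j) + 1) (fun _ _ => Nat.zero_le _)
        (mem_range.2 hj)
    · intro z hz
      obtain ⟨w, hw, h⟩ := hF z hz
      refine mem_mul.2 ⟨w, hw, w⁻¹ * z, (hY _).2 ?_, by simp⟩
      have : (A' ∩ ((w⁻¹ * z) • A')).card = ((w • A') ∩ (z • A')).card := by
        rw [← card_smul_finset w (A' ∩ _), smul_finset_inter, smul_smul, mul_inv_cancel_left]
      rw [this]
      calc _ ≤ q L j * A'.card := h1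
        _ ≤ q L j * _ := Nat.mul_le_mul_left _ h
        _ = _ := by simp only [q]; ring

lemma inter_cover {G : Type} [Group G] [DecidableEq G] (Z Y₁ Y₂ F₁ F₂ : Finset G)
    (h₁ : Z ⊆ F₁ * Y₁) (h₂ : Z ⊆ F₂ * Y₂) :
    ∃ F ⊆ Z, F.card ≤ F₁.card * F₂.card ∧ Z ⊆ F * ((Y₁⁻¹ * Y₁) ∩ (Y₂⁻¹ * Y₂)) := by
  classical
  have hc : ∀ z : G, ∃ p : G × G, z ∈ Z →
      p ∈ F₁ ×ˢ F₂ ∧ p.1⁻¹ * z ∈ Y₁ ∧ p.2⁻¹ * z ∈ Y₂ := by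
    intro z
    by_cases hz : z ∈ Z
    · obtain ⟨a, ha, y, hy, e⟩ := mem_mul.1 (h₁ hz)
      obtain ⟨b, hb, y', hy', e'⟩ := mem_mul.1 (h₂ hz)
      refine ⟨(a, b), fun _ => ⟨mem_product.2 ⟨ha, hb⟩, ?_, ?_⟩⟩
      · simpa [← e] using hy
      · simpa [← e'] using hy'
    · exact ⟨1, fun h => absurd h hz⟩
  choose f hf using hc
  have hg : ∀ p : G × G, ∃ b : G, p ∈ Z.image f → b ∈ Z ∧ f b = p := by
    intro p
    by_cases hp : p ∈ Z.image f
    · obtain ⟨b, hb⟩ := mem_image.1 hp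
      exact ⟨b, fun _ => hb⟩
    · exact ⟨1, fun h => absurd h hp⟩
  choose g hg using hg
  refine ⟨(Z.image f).image g, ?_, ?_, ?_⟩
  · intro x hx
    obtain ⟨p, hp, rfl⟩ := mem_image.1 hx
    exact (hg p hp).1
  · rw [← card_product]
    refine card_image_le.trans (card_le_card ?_)
    intro p hp
    obtain ⟨z, hz, rfl⟩ := mem_image.1 hp
    exact (hf z hz).1
  · intro z hz
    have hp := mem_image_of_mem f hz
    obtain ⟨hb, e⟩ := hg _ hp
    obtain ⟨-, hz1, hz2⟩ := hf z hz
    obtain ⟨-, hb1, hb2⟩ := hf _ hb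
    rw [e] at hb1 hb2
    refine mem_mul.2 ⟨_, mem_image_of_mem g hp, (g (f z))⁻¹ * z, mem_inter.2 ⟨?_, ?_⟩, by simp⟩
    · exact mem_mul.2 ⟨_, inv_mem_inv hb1, _, hz1, by group⟩
    · exact mem_mul.2 ⟨_, inv_mem_inv hb2, _, hz2, by group⟩

lemma tripling {G : Type} [Group G] [DecidableEq G] (X : Finset G) (k : ℕ) (hX : X.Nonempty)
    (h : (X ^ 3).card ≤ k * X.card) (M : ℕ) (hM : 3 ≤ M) :
    ((X ∪ X⁻¹ ∪ (1 : Finset G)) ^ M).card ≤ (32 * k ^ 3) ^ (M - 2) * 3 * X.card := by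
  have hR : ((X ^ 3).card : ℝ) ≤ (k : ℝ) * X.card := by exact_mod_cast h
  have alt : ∀ a b c : ℤ, |a| = 1 → |b| = 1 → |c| = 1 →
      (X ^ a * X ^ b * X ^ c).card ≤ k ^ 3 * X.card := by
    intro a b c ha hb hc
    have := small_alternating_pow_of_small_tripling (m := 3) le_rfl hR ![a, b, c] (by
      intro i; fin_cases i <;> simpa)
    simp [List.finRange_succ, ← mul_assoc] at this
    exact_mod_cast this
  set T := X ∪ X⁻¹ with hT
  have hTne : T.Nonempty := hX.mono subset_union_left
  have hT3 : (T ^ 3).card ≤ 8 * k ^ 3 * X.card := by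
    have e : T ^ 3 ⊆ ((X ^ (1:ℤ) * X ^ (1:ℤ) * X ^ (1:ℤ) ∪ X ^ (1:ℤ) * X ^ (1:ℤ) * X ^ (-1:ℤ)) ∪
        (X ^ (1:ℤ) * X ^ (-1:ℤ) * X ^ (1:ℤ) ∪ X ^ (1:ℤ) * X ^ (-1:ℤ) * X ^ (-1:ℤ))) ∪
        ((X ^ (-1:ℤ) * X ^ (1:ℤ) * X ^ (1:ℤ) ∪ X ^ (-1:ℤ) * X ^ (1:ℤ) * X ^ (-1:ℤ)) ∪
        (X ^ (-1:ℤ) * X ^ (-1:ℤ) * X ^ (1:ℤ) ∪ X ^ (-1:ℤ) * X ^ (-1:ℤ) * X ^ (-1:ℤ))) := by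
      simp only [zpow_one, zpow_neg, pow_succ, pow_zero, one_mul, hT, union_mul, mul_union]
      intro x hx
      simp only [mem_union] at hx ⊢
      tauto
    have h1 := alt 1 1 1 (by simp) (by simp) (by simp)
    have h2 := alt 1 1 (-1) (by simp) (by simp) (by simp)
    have h3 := alt 1 (-1) 1 (by simp) (by simp) (by simp)
    have h4 := alt 1 (-1) (-1) (by simp) (by simp) (by simp)
    have h5 := alt (-1) 1 1 (by simp) (by simp) (by simp)
    have h6 := alt (-1) 1 (-1) (by simp) (by simp) (by simp)
    have h7 := alt (-1) (-1) 1 (by simp) (by simp) (by simp)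
    have h8 := alt (-1) (-1) (-1) (by simp) (by simp) (by simp)
    refine (card_le_card e).trans ?_
    have u : ∀ {P Q : Finset G} {p r : ℕ}, P.card ≤ p → Q.card ≤ r → (P ∪ Q).card ≤ p + r :=
      fun hp hq => (card_union_le _ _).trans (add_le_add hp hq)
    refine (u (u (u h1 h2) (u h3 h4)) (u (u h5 h6) (u h7 h8))).trans (le_of_eq (by ring))
  set W := T ∪ (1 : Finset G) with hW
  have hWinv : W⁻¹ = W := by
    ext x
    simp only [hW, hT, mem_inv', mem_union, mem_one, inv_inv, inv_eq_one]
    tauto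
  have hXW : X ⊆ W := subset_union_left.trans subset_union_left
  have hW3 : (W ^ 3).card ≤ 32 * k ^ 3 * X.card := by
    have e : W ^ 3 ⊆ ((1 : Finset G) ∪ T) ∪ (T ^ 2 ∪ T ^ 3) := by
      simp only [pow_succ, pow_zero, one_mul, hW, union_mul, mul_union, mul_one]
      intro x hx
      simp only [mem_union] at hx ⊢
      tauto
    have a3 : (T ^ 2).card ≤ (T ^ 3).card := card_pow_mono (by simp) (by simp)
    have a2 : T.card ≤ (T ^ 3).card := card_le_card_pow (by simp)
    have a1 : (1 : Finset G).card ≤ (T ^ 3).card := by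
      rw [card_one]; exact (hTne.pow).card_pos
    have u : ∀ {P Q : Finset G} {p r : ℕ}, P.card ≤ p → Q.card ≤ r → (P ∪ Q).card ≤ p + r :=
      fun hp hq => (card_union_le _ _).trans (add_le_add hp hq)
    refine ((card_le_card e).trans (u (u a1 a2) (u a3 le_rfl))).trans ?_
    linarith
  have hW1 : W.card ≤ 3 * X.card := by
    have h1 := card_union_le T (1 : Finset G)
    have h2 := card_union_le X X⁻¹
    rw [card_inv] at h2
    rw [card_one] at h1
    have := hX.card_pos
    rw [← hT] at h2
    rw [← hW] at h1
    omega
  have hWR : ((W ^ 3).card : ℝ) ≤ ((32 * k ^ 3 : ℕ) : ℝ) * W.card := by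
    exact_mod_cast hW3.trans (Nat.mul_le_mul_left _ (card_le_card hXW))
  have := small_pow_of_small_tripling hM hWR hWinv
  have h' : (W ^ M).card ≤ (32 * k ^ 3) ^ (M - 2) * W.card := by exact_mod_cast this
  calc _ ≤ _ := h'
    _ ≤ (32 * k ^ 3) ^ (M - 2) * (3 * X.card) := Nat.mul_le_mul_left _ hW1
    _ = _ := by ring

end SCS

/-- **Sanders–Croot–Sisask for small tripling.** For all positive integers `k`, `m`, `n`
there is `C` such that: if `G` is a group and `X ⊆ G` is nonempty finite with
`|X³| ≤ k|X|`, then there is a finite symmetric `Y ⊆ G` with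
`Yⁿ ⊆ (XX⁻¹)² ∩ X²X⁻² ∩ (X⁻¹X)² ∩ X⁻²X²` such that `X̄ᵐ` is covered by at most `C`
translates `aY` with `a ∈ X̄ᵐ`, where `X̄ = X ∪ X⁻¹ ∪ {1}`. -/
theorem sanders_croot_sisask_tripling (k m n : ℕ) (hk : 0 < k) (hm : 0 < m)
    (hn : 0 < n) :
    ∃ C : ℕ, ∀ (G : Type) [Group G] [DecidableEq G],
      ∀ X : Finset G, X.Nonempty →
      (X ^ 3).card ≤ k * X.card →
      ∃ Y : Finset G, (1 : G) ∈ Y ∧ Y⁻¹ = Y ∧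
        Y ^ n ⊆ (X * X⁻¹) ^ 2 ∩ (X ^ 2 * X⁻¹ ^ 2) ∩ (X⁻¹ * X) ^ 2 ∩ (X⁻¹ ^ 2 * X ^ 2) ∧
        ∃ F : Finset G, F ⊆ (X ∪ X⁻¹ ∪ (1 : Finset G)) ^ m ∧ F.card ≤ C ∧
          (X ∪ X⁻¹ ∪ (1 : Finset G)) ^ m ⊆ F * Y := by
  classical
  obtain ⟨C, hC⟩ := SCS.single ((32 * k ^ 3) ^ (3 - 2) * 3) ((32 * k ^ 3) ^ (m + 3 - 2) * 3)
    (4 * n) (by omega)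
  refine ⟨(C * C) * (C * C), ?_⟩
  intro G _ _ X hX h3
  have t3 := SCS.tripling X k hX h3 3 le_rfl
  have tm := SCS.tripling X k hX h3 (m + 3) (by omega)
  set W := X ∪ X⁻¹ ∪ (1 : Finset G) with hW
  have hXW : X ⊆ W := Finset.subset_union_left.trans Finset.subset_union_left
  have hXW' : X⁻¹ ⊆ W := Finset.subset_union_right.trans Finset.subset_union_left
  have h1W : (1 : G) ∈ W := Finset.mem_union_right _ (by simp)
  have gen : ∀ A B : Finset G, A ⊆ W → B ⊆ W → A.Nonempty → B.Nonempty →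
      A.card = X.card → B.card = X.card →
      ∃ Y : Finset G, (1 : G) ∈ Y ∧ Y⁻¹ = Y ∧ Y ^ (4 * n) ⊆ (A * B) * (A * B)⁻¹ ∧
        ∃ F ⊆ W ^ m, F.card ≤ C ∧ W ^ m ⊆ F * Y := by
    intro A B hA hB hA' hB' hAc hBc
    refine hC G A B (W ^ m) hA' hB' ?_ ?_
    · rw [hBc]
      refine (Finset.card_le_card ?_).trans t3
      calc A * B ⊆ W * W := Finset.mul_subset_mul hA hB
        _ = W ^ 2 := (sq W).symm
        _ ⊆ W ^ 3 := Finset.pow_subset_pow_right h1W (by omega)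
    · rw [hAc]
      refine (Finset.card_le_card ?_).trans tm
      calc W ^ m * A ⊆ W ^ m * W := Finset.mul_subset_mul_left hA
        _ = W ^ (m + 1) := (pow_succ W m).symm
        _ ⊆ W ^ (m + 3) := Finset.pow_subset_pow_right h1W (by omega)
  have hXi : X⁻¹.Nonempty := hX.inv
  have hXc : X⁻¹.card = X.card := Finset.card_inv X
  obtain ⟨Y₁, o₁, i₁, p₁, F₁, -, c₁, v₁⟩ := gen X X⁻¹ hXW hXW' hX hXi rfl hXc
  obtain ⟨Y₂, o₂, i₂, p₂, F₂, -, c₂, v₂⟩ := gen X X hXW hXW hX hX rfl rfl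
  obtain ⟨Y₃, o₃, i₃, p₃, F₃, -, c₃, v₃⟩ := gen X⁻¹ X hXW' hXW hXi hX hXc rfl
  obtain ⟨Y₄, o₄, i₄, p₄, F₄, -, c₄, v₄⟩ := gen X⁻¹ X⁻¹ hXW' hXW' hXi hXi hXc hXc
  obtain ⟨F₅, -, c₅, v₅⟩ := SCS.inter_cover _ _ _ _ _ v₁ v₂
  obtain ⟨F₆, -, c₆, v₆⟩ := SCS.inter_cover _ _ _ _ _ v₃ v₄
  obtain ⟨F, hF, c, v⟩ := SCS.inter_cover _ _ _ _ _ v₅ v₆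
  have sym : ∀ P Q : Finset G, ((P⁻¹ * P) ∩ (Q⁻¹ * Q))⁻¹ = (P⁻¹ * P) ∩ (Q⁻¹ * Q) := by
    intro P Q
    have e : ∀ P : Finset G, (P⁻¹ * P)⁻¹ = P⁻¹ * P := fun P => by simp
    ext x
    rw [Finset.mem_inv', Finset.mem_inter, Finset.mem_inter, ← Finset.mem_inv',
      ← Finset.mem_inv', e, e]
  have one : ∀ P Q : Finset G, (1 : G) ∈ P → (1 : G) ∈ Q →
      (1 : G) ∈ (P⁻¹ * P) ∩ (Q⁻¹ * Q) := by
    intro P Q hP hQ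
    refine Finset.mem_inter.2 ⟨?_, ?_⟩
    · exact Finset.mem_mul.2 ⟨1, by simpa using hP, 1, hP, by simp⟩
    · exact Finset.mem_mul.2 ⟨1, by simpa using hQ, 1, hQ, by simp⟩
  refine ⟨_, one _ _ (one _ _ o₁ o₂) (one _ _ o₃ o₄), sym _ _, ?_, F, hF, ?_, v⟩
  · rw [sym, sym, i₁, i₂, i₃, i₄, ← sq, ← sq, ← sq, ← sq, ← sq, ← sq]
    have red : ∀ (Y P T : Finset G), P ⊆ Y ^ 2 → Y ^ (4 * n) ⊆ T → ∀ S, S ⊆ P ^ 2 → S ^ n ⊆ T := by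
      intro Y P T hP hT S hS
      refine subset_trans ?_ hT
      have : S ⊆ Y ^ 4 := hS.trans (by
        simpa [← pow_mul] using Finset.pow_subset_pow_left (n := 2) hP)
      simpa [← pow_mul] using Finset.pow_subset_pow_left (n := n) this
    refine Finset.subset_inter (Finset.subset_inter (Finset.subset_inter ?_ ?_) ?_) ?_
    · refine red Y₁ _ _ Finset.inter_subset_left (p₁.trans (subset_of_eq ?_)) _
        Finset.inter_subset_left
      simp [sq]
    · refine red Y₂ _ _ Finset.inter_subset_right (p₂.trans (subset_of_eq ?_)) _
        Finset.inter_subset_left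
      simp [sq]
    · refine red Y₃ _ _ Finset.inter_subset_left (p₃.trans (subset_of_eq ?_)) _
        Finset.inter_subset_right
      simp [sq]
    · refine red Y₄ _ _ Finset.inter_subset_right (p₄.trans (subset_of_eq ?_)) _
        Finset.inter_subset_right
      simp [sq]
  · exact c.trans (Nat.mul_le_mul (c₅.trans (Nat.mul_le_mul c₁ c₂))
      (c₆.trans (Nat.mul_le_mul c₃ c₄)))
end

section
/- Let G be a finite group, A ⊆ G a subset, and ε > 0. If H is a subgroup of G such that every x ∈ H satisfies |xA △ A| ≤ ε|G|, then there is a set D ⊆ G which is a union of right cosets of H such that |A △ D| ≤ ε|G|. -/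
open Pointwise

theorem stab_aux_card {G : Type*} [Fintype G] [DecidableEq G] (A B : Finset G) :
    ((symmDiff A B).card : ℝ) = ∑ g : G, ((if g ∈ A then (1:ℝ) else 0) + (if g ∈ B then 1 else 0)
      - 2 * (if g ∈ A then 1 else 0) * (if g ∈ B then 1 else 0)) := by
  have h : ((symmDiff A B).card : ℝ) = ∑ g : G, if g ∈ symmDiff A B then (1:ℝ) else 0 := by
    simp
  rw [h]
  refine Finset.sum_congr rfl fun g _ => ?_
  by_cases h1 : g ∈ A <;> by_cases h2 : g ∈ B <;> simp [Finset.mem_symmDiff, h1, h2] <;> norm_num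

theorem stab_aux_avg {G : Type*} [Group G] [Fintype G] (H : Subgroup G) [Fintype H] (F : G → ℝ) :
    (Fintype.card H : ℝ) * ∑ g, F g = ∑ g, ∑ h : H, F (h * g) := by
  rw [Finset.sum_comm]
  have : ∀ h : H, ∑ g, F (h * g) = ∑ g, F g := fun h =>
    Fintype.sum_equiv (Equiv.mulLeft (h : G)) _ _ (fun _ => rfl)
  simp [this]

/-- If `G` is a finite group, `A ⊆ G`, `ε > 0`, and `H ≤ G` is a subgroup with
`|xA △ A| ≤ ε|G|` for all `x ∈ H`, then there is a union `D` of right cosets of `H` with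
`|A △ D| ≤ ε|G|`. -/
theorem stab_structure (G : Type*) [Group G] [Fintype G] [DecidableEq G]
    (A : Finset G) (ε : ℝ) (hε : 0 < ε) (H : Subgroup G)
    (hH : ∀ x : G, x ∈ H → (((symmDiff (x • A) A).card : ℝ)) ≤ ε * (Fintype.card G : ℝ)) :
    ∃ D : Finset G, (∀ x ∈ D, ∀ h ∈ H, h * x ∈ D) ∧
      ((symmDiff A D).card : ℝ) ≤ ε * (Fintype.card G : ℝ) := by
  classical
  let u : G → ℝ := fun g => if g ∈ A then 1 else 0
  let n : ℝ := (Fintype.card H : ℝ)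
  let a : G → ℝ := fun g => ∑ h : H, u (h * g)
  have hn : 0 < n := by
    have : 0 < Fintype.card H := Fintype.card_pos
    exact Nat.cast_pos.2 this
  have ha : ∀ (k : H) (g : G), a (k * g) = a g := by
    intro k g
    refine Fintype.sum_equiv (Equiv.mulRight k) _ _ (fun h => ?_)
    simp [mul_assoc]
  have hu0 : ∀ g, 0 ≤ u g ∧ u g ≤ 1 := by
    intro g
    by_cases h : g ∈ A <;> simp [u, h]
  have ha0 : ∀ g, 0 ≤ a g := fun g => Finset.sum_nonneg fun h _ => (hu0 _).1
  have han : ∀ g, a g ≤ n := by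
    intro g
    calc a g ≤ ∑ h : H, (1:ℝ) := Finset.sum_le_sum fun h _ => (hu0 _).2
      _ = n := by simp [n]
  let D : Finset G := Finset.univ.filter fun g => n ≤ 2 * a g
  have hD : ∀ g, g ∈ D ↔ n ≤ 2 * a g := by simp [D]
  refine ⟨D, ?_, ?_⟩
  · intro x hx h hh
    rw [hD] at hx ⊢
    rwa [ha ⟨h, hh⟩ x]
  let v : G → ℝ := fun g => if g ∈ D then 1 else 0
  have hv : ∀ (k : H) (g : G), v (k * g) = v g := by
    intro k g
    simp only [v, hD, ha]
  have key1 : n * ((symmDiff A D).card : ℝ) = ∑ g, (a g + n * v g - 2 * a g * v g) := by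
    rw [stab_aux_card, stab_aux_avg H]
    refine Finset.sum_congr rfl fun g _ => ?_
    change ∑ h : H, (u (h * g) + v (h * g) - 2 * u (h * g) * v (h * g)) = _
    simp only [hv, Finset.sum_sub_distrib, Finset.sum_add_distrib, ← Finset.sum_mul,
      ← Finset.mul_sum]
    simp [a, n]
  have key2 : ∑ h : H, ((symmDiff (((h⁻¹ : H) : G) • A) A).card : ℝ)
      = ∑ g, (a g + n * u g - 2 * a g * u g) := by
    simp only [stab_aux_card]
    rw [Finset.sum_comm]
    refine Finset.sum_congr rfl fun g _ => ?_
    have : ∀ h : H, (if g ∈ ((h⁻¹ : H) : G) • A then (1:ℝ) else 0) = u (h * g) := by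
      intro h
      have : g ∈ ((h⁻¹ : H) : G) • A ↔ (h : G) * g ∈ A := by
        rw [← Finset.inv_smul_mem_iff]
        simp
      simp only [u, this]
    simp only [this]
    change ∑ h : H, (u (h * g) + u g - 2 * u (h * g) * u g) = _
    simp only [Finset.sum_sub_distrib, Finset.sum_add_distrib, ← Finset.sum_mul,
      ← Finset.mul_sum]
    simp [a, n]
  have key3 : n * ∑ g, (a g + n * u g - 2 * a g * u g) = ∑ g, 2 * (a g * (n - a g)) := by
    rw [stab_aux_avg H]
    refine Finset.sum_congr rfl fun g _ => ?_
    simp only [ha, Finset.sum_sub_distrib, Finset.sum_add_distrib, ← Finset.mul_sum]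
    change ∑ h : H, a g + n * a g - 2 * a g * a g = _
    simp only [Finset.sum_const, Finset.card_univ, nsmul_eq_mul]
    change n * a g + n * a g - 2 * a g * a g = _
    ring
  have key4 : ∑ h : H, ((symmDiff (((h⁻¹ : H) : G) • A) A).card : ℝ)
      ≤ n * (ε * (Fintype.card G : ℝ)) := by
    calc _ ≤ ∑ h : H, (ε * (Fintype.card G : ℝ)) :=
          Finset.sum_le_sum fun h _ => hH _ (h⁻¹).2
      _ = _ := by simp [n]
  have key5 : n * ∑ g, (a g + n * v g - 2 * a g * v g) ≤ ∑ g, 2 * (a g * (n - a g)) := by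
    rw [Finset.mul_sum]
    refine Finset.sum_le_sum fun g _ => ?_
    have h0 := ha0 g
    have h1 := han g
    by_cases h : n ≤ 2 * a g
    · have : v g = 1 := by simp [v, hD, h]
      rw [this]
      nlinarith [mul_nonneg (sub_nonneg.2 h1) (sub_nonneg.2 h)]
    · have : v g = 0 := by simp only [v, hD, h, if_false]
      rw [this]
      nlinarith [mul_nonneg h0 (sub_nonneg.2 (not_le.1 h).le)]
  rw [← key1, ← key3, ← key2] at key5
  have h6 := le_of_mul_le_mul_left key5 hn
  exact le_of_mul_le_mul_left (h6.trans key4) hn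
end

section
/- Let G be a finite group, A ⊆ G a subset, and ε > 0. If H is a subgroup of G such that every x ∈ H satisfies |xA △ A| ≤ ε|G|, then there is a set Z ⊆ G with |Z| < (1/2)ε^{1/2}|G| such that for every x ∈ G \ Z, either |Hx ∩ A| ≤ ε^{1/4}|H| or |Hx \ A| ≤ ε^{1/4}|H|. -/
open Pointwise

/-- If `G` is a finite group, `A ⊆ G`, `ε > 0`, and `H ≤ G` is a subgroup with
`|xA △ A| ≤ ε|G|` for all `x ∈ H`, then there is `Z ⊆ G` with `|Z| < ε^{1/2}|G|/2` such
that for every `x ∉ Z`, either `|Hx ∩ A| ≤ ε^{1/4}|H|` or `|Hx \ A| ≤ ε^{1/4}|H|`. -/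
theorem stab_regularity (G : Type*) [Group G] [Fintype G] [DecidableEq G]
    (A : Finset G) (ε : ℝ) (hε : 0 < ε) (H : Subgroup G)
    (hH : ∀ x : G, x ∈ H → (((symmDiff (x • A) A).card : ℝ)) ≤ ε * (Fintype.card G : ℝ)) :
    ∃ Z : Finset G, ((Z.card : ℝ) < (1 / 2) * ε ^ ((1 : ℝ) / 2) * (Fintype.card G : ℝ)) ∧
      ∀ x : G, x ∉ Z →
        ((Nat.card ↥(((H : Set G) * {x}) ∩ (A : Set G)) : ℝ)
            ≤ ε ^ ((1 : ℝ) / 4) * (Nat.card H : ℝ)) ∨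
        ((Nat.card ↥(((H : Set G) * {x}) \ (A : Set G)) : ℝ)
            ≤ ε ^ ((1 : ℝ) / 4) * (Nat.card H : ℝ)) := by
  classical
  set δ : ℝ := ε ^ ((1 : ℝ) / 4) with hδ
  have hδ0 : 0 < δ := Real.rpow_pos_of_pos hε _
  have hδ2 : ε ^ ((1 : ℝ) / 2) = δ ^ 2 := by
    rw [hδ, ← Real.rpow_natCast, ← Real.rpow_mul hε.le]; norm_num
  have hδ4 : ε = δ ^ 4 := by
    rw [hδ, ← Real.rpow_natCast, ← Real.rpow_mul hε.le]; norm_num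
  let a : G → ℕ := fun g => (Finset.univ.filter fun k : H => (k : G) * g ∈ A).card
  let b : G → ℕ := fun g => (Finset.univ.filter fun k : H => (k : G) * g ∉ A).card
  have ha : ∀ g, Nat.card ↥(((H : Set G) * {g}) ∩ (A : Set G)) = a g := by
    intro g
    have h1 : (((H : Set G) * {g}) ∩ (A : Set G)) =
        (fun k : H => (k : G) * g) '' {k : H | (k : G) * g ∈ A} := by
      ext y
      simp only [Set.mul_singleton, Set.mem_inter_iff, Set.mem_image, Set.mem_setOf_eq,
        SetLike.mem_coe, Subtype.exists]
      constructor
      · rintro ⟨⟨k, hk, rfl⟩, h⟩; exact ⟨k, hk, h, rfl⟩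
      · rintro ⟨k, hk, h, rfl⟩; exact ⟨⟨k, hk, rfl⟩, h⟩
    rw [h1, Nat.card_image_of_injective]
    · rw [Nat.card_eq_fintype_card, Fintype.card_subtype]; rfl
    · intro k l h; exact Subtype.ext (mul_right_cancel h)
  have hb : ∀ g, Nat.card ↥(((H : Set G) * {g}) \ (A : Set G)) = b g := by
    intro g
    have h1 : (((H : Set G) * {g}) \ (A : Set G)) =
        (fun k : H => (k : G) * g) '' {k : H | (k : G) * g ∉ A} := by
      ext y
      simp only [Set.mul_singleton, Set.mem_diff, Set.mem_image, Set.mem_setOf_eq,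
        SetLike.mem_coe, Subtype.exists]
      constructor
      · rintro ⟨⟨k, hk, rfl⟩, h⟩; exact ⟨k, hk, h, rfl⟩
      · rintro ⟨k, hk, h, rfl⟩; exact ⟨⟨k, hk, rfl⟩, h⟩
    rw [h1, Nat.card_image_of_injective]
    · rw [Nat.card_eq_fintype_card, Fintype.card_subtype]; rfl
    · intro k l h; exact Subtype.ext (mul_right_cancel h)
  simp only [ha, hb]
  let F : H → H → ℕ := fun k l =>
    (Finset.univ.filter fun g : G => (k : G) * g ∈ A ∧ (l : G) * g ∉ A).card
  have hF : ∀ k l : H, (F k l : ℝ) + F l k ≤ ε * (Fintype.card G : ℝ) := by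
    intro k l
    refine le_trans ?_ (hH ((k : G) * (l : G)⁻¹) (H.mul_mem k.2 (H.inv_mem l.2)))
    norm_cast
    have hd : Disjoint (Finset.univ.filter fun g : G => (k : G) * g ∈ A ∧ (l : G) * g ∉ A)
        (Finset.univ.filter fun g : G => (l : G) * g ∈ A ∧ (k : G) * g ∉ A) := by
      rw [Finset.disjoint_filter]; tauto
    show Finset.card _ + Finset.card _ ≤ _
    rw [← Finset.card_union_of_disjoint hd]
    refine Finset.card_le_card_of_injOn (fun g => (k : G) * g) ?_
      (fun x _ y _ h => mul_left_cancel h)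
    intro g hg
    have h2 : (k : G) * g ∈ ((k : G) * (l : G)⁻¹) • A ↔ (l : G) * g ∈ A := by
      rw [← Finset.inv_smul_mem_iff]
      simp [mul_assoc]
    simp only [Finset.coe_union, Finset.coe_filter, Finset.mem_univ, true_and, Set.mem_union,
      Set.mem_setOf_eq] at hg
    simp only [Finset.mem_coe, Finset.mem_symmDiff, h2]
    tauto
  have hsum : ∑ k : H, ∑ l : H, F k l = ∑ g : G, a g * b g := by
    simp only [F, a, b, Finset.card_filter, Finset.sum_mul_sum]
    rw [Finset.sum_comm' (t' := Finset.univ) (s' := fun _ => Finset.univ) (by simp)]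
    rw [Finset.sum_comm]
    simp_rw [fun k : H => Finset.sum_comm (s := (Finset.univ : Finset H))
      (t := (Finset.univ : Finset G)) (f := fun l g =>
        if (k : G) * g ∈ A ∧ (l : G) * g ∉ A then 1 else 0)]
    rw [Finset.sum_comm]
    refine Finset.sum_congr rfl fun g _ => Finset.sum_congr rfl fun k _ =>
      Finset.sum_congr rfl fun l _ => ?_
    by_cases h1 : (k : G) * g ∈ A <;> by_cases h2 : (l : G) * g ∈ A <;> simp [h1, h2]
  set n : ℝ := (Nat.card H : ℝ) with hn
  have hn0 : 0 < n := by rw [hn]; exact_mod_cast Nat.card_pos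
  have hG0 : 0 < (Fintype.card G : ℝ) := by exact_mod_cast Fintype.card_pos
  have hmain : 2 * ∑ g : G, (a g : ℝ) * b g ≤ n ^ 2 * (ε * (Fintype.card G : ℝ)) := by
    have h1 : ∑ g : G, (a g : ℝ) * b g = ∑ k : H, ∑ l : H, (F k l : ℝ) := by
      exact_mod_cast hsum.symm
    have h2 : ∑ k : H, ∑ l : H, ((F k l : ℝ) + F l k) ≤
        ∑ k : H, ∑ l : H, ε * (Fintype.card G : ℝ) :=
      Finset.sum_le_sum fun k _ => Finset.sum_le_sum fun l _ => hF k l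
    simp only [Finset.sum_add_distrib] at h2
    rw [Finset.sum_comm (f := fun k l : H => (F l k : ℝ))] at h2
    simp only [Finset.sum_const, Finset.card_univ, nsmul_eq_mul,
      ← Nat.card_eq_fintype_card (α := H)] at h2
    rw [h1]
    rw [← hn] at h2
    linarith
  refine ⟨Finset.univ.filter fun g => δ * n < a g ∧ δ * n < b g, ?_, ?_⟩
  · set Z := Finset.univ.filter fun g => δ * n < a g ∧ δ * n < b g with hZ
    rw [hδ2]
    rcases Z.eq_empty_or_nonempty with h | h
    · have h0 : (Z.card : ℝ) = 0 := by
        rw [Finset.card_eq_zero.2 h, Nat.cast_zero]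
      rw [h0]
      exact mul_pos (mul_pos (by norm_num) (pow_pos hδ0 2)) hG0
    have h1 : ∑ g ∈ Z, (δ * n) * (δ * n) < ∑ g ∈ Z, (a g : ℝ) * b g := by
      refine Finset.sum_lt_sum_of_nonempty h fun g hg => ?_
      have hg' := (Finset.mem_filter.1 hg).2
      have : 0 < δ * n := by positivity
      exact mul_lt_mul'' hg'.1 hg'.2 this.le this.le
    have h2 : ∑ g ∈ Z, (a g : ℝ) * b g ≤ ∑ g : G, (a g : ℝ) * b g :=
      Finset.sum_le_sum_of_subset_of_nonneg (Finset.subset_univ _)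
        fun _ _ _ => mul_nonneg (Nat.cast_nonneg _) (Nat.cast_nonneg _)
    rw [Finset.sum_const, nsmul_eq_mul] at h1
    rw [hδ4] at hmain
    have hc : 0 < 2 * (δ ^ 2 * n ^ 2) := by positivity
    refine lt_of_mul_lt_mul_left ?_ hc.le
    nlinarith
  · intro x hx
    simp only [Finset.mem_filter, Finset.mem_univ, true_and, not_and_or, not_lt] at hx
    exact hx
end

section
/- For every positive integer d and every real ε > 0 there is a constant C = C(d, ε) such that the following holds. If G is a purely nonabelian finite group and A ⊆ G has VC-dimension at most d, then there is a normal subgroup H of G with [G : H] ≤ C satisfying: (i) there is a set D ⊆ G which is a union of cosets of H such that |A △ D| ≤ ε|G|; and (ii) there is a set Z ⊆ G with |Z| < (1/2)ε^{1/2}|G| such that for every x ∈ G \ Z, either |xH ∩ A| ≤ ε^{1/4}|H| or |xH \ A| ≤ ε^{1/4}|H|. -/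
open Pointwise

/-- A nontrivial group `G` is purely nonabelian if every normal subgroup `H ≤ G`
satisfies `⁅H, H⁆ = H`, i.e. no normal subgroup has a nontrivial abelian quotient. -/
def PurelyNonabelian (G : Type*) [Group G] : Prop :=
  Nontrivial G ∧ ∀ H : Subgroup G, H.Normal → ⁅H, H⁆ = H

/-- `A` has VC-dimension at most `d`: any finite set `X ⊆ G` shattered by the left
translates of `A` has at most `d` elements. -/
def VCDimLE {G : Type*} [Group G] (A : Set G) (d : ℕ) : Prop :=
  ∀ X : Finset G,
    (∀ S : Finset G, S ⊆ X → ∃ g : G, (S : Set G) = (X : Set G) ∩ (g • A)) →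
    X.card ≤ d


open commutatorElement in
theorem jordan_aux {G R : Type*} [Group G] [Finite G] [NormedRing R] [NormedAlgebra ℝ R]
    [FiniteDimensional ℝ R] (hG : PurelyNonabelian G) (ρ : G →* R) (hρ : ∀ g, ‖ρ g‖ ≤ 1) :
    ρ.ker.index ≤ 5 ^ Module.finrank ℝ R := by
  classical
  have hmul : ∀ g h, ρ (g * h) = ρ g * ρ h := fun g h => map_mul ρ g h
  have hinv : ∀ g, ρ g * ρ g⁻¹ = 1 := fun g => by rw [← hmul]; simp
  have hinv' : ∀ g, ρ g⁻¹ * ρ g = 1 := fun g => by rw [← hmul]; simp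
  have hle : ∀ (g h : G) (r : R), ‖ρ g * r * ρ h‖ ≤ ‖r‖ := fun g h r => by
    calc ‖ρ g * r * ρ h‖ ≤ ‖ρ g‖ * ‖r‖ * ‖ρ h‖ := norm_mul₃_le
      _ ≤ 1 * ‖r‖ * 1 := by gcongr <;> apply hρ
      _ = ‖r‖ := by ring
  have hle' : ∀ (h : G) (r : R), ‖r * ρ h‖ ≤ ‖r‖ := fun h r => by
    simpa using hle 1 h r
  set S : Set G := {g | ‖ρ g - 1‖ < 1/2} with hS
  have hconj : ∀ g h, ‖ρ (g * h * g⁻¹) - 1‖ ≤ ‖ρ h - 1‖ := fun g h => by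
    have : ρ (g * h * g⁻¹) - 1 = ρ g * (ρ h - 1) * ρ g⁻¹ := by
      rw [hmul, hmul, mul_sub, sub_mul, mul_one, hinv]
    rw [this]; exact hle _ _ _
  have hcomm : ∀ g h, ‖ρ ⁅g, h⁆ - 1‖ ≤ 2 * ‖ρ g - 1‖ * ‖ρ h - 1‖ := fun g h => by
    have : ρ ⁅g, h⁆ - 1 = ((ρ g - 1) * (ρ h - 1) - (ρ h - 1) * (ρ g - 1)) * ρ (h * g)⁻¹ := by
      have e1 : (ρ g - 1) * (ρ h - 1) - (ρ h - 1) * (ρ g - 1) = ρ (g * h) - ρ (h * g) := by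
        rw [hmul, hmul]; noncomm_ring
      rw [e1, sub_mul, hinv, ← hmul]
      congr 2
      simp [commutatorElement_def, mul_assoc]
    rw [this]
    refine (hle' _ _).trans ((norm_sub_le _ _).trans ?_)
    have h1 := norm_mul_le (ρ g - 1) (ρ h - 1)
    have h2 := norm_mul_le (ρ h - 1) (ρ g - 1)
    nlinarith
  have hSker : ∀ g ∈ S, g ∈ ρ.ker := by
    by_contra! hcon
    obtain ⟨g, ⟨hgS, hgk⟩, hmin⟩ := Set.exists_min_image {g | g ∈ S ∧ g ∉ ρ.ker}
      (fun g => ‖ρ g - 1‖) (Set.toFinite _) hcon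
    have hpos : 0 < ‖ρ g - 1‖ := by
      rw [norm_pos_iff, sub_ne_zero]; exact hgk
    have hgc : ∀ s ∈ S, ρ ⁅g, s⁆ = 1 := by
      intro s hs
      by_contra hne
      have hlt : ‖ρ ⁅g, s⁆ - 1‖ < ‖ρ g - 1‖ := by
        have := hcomm g s
        have hs' : ‖ρ s - 1‖ < 1/2 := hs
        nlinarith
      have hgS' : ‖ρ g - 1‖ < 1/2 := hgS
      have := hmin ⁅g, s⁆ ⟨hlt.trans hgS', hne⟩
      linarith
    set φ := ρ.toHomUnits with hφ
    have hφv : ∀ g, (φ g : R) = ρ g := fun g => rfl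
    have hφk : ∀ g, φ g = 1 ↔ ρ g = 1 := fun g => by rw [Units.ext_iff, hφv]; rfl
    have hNmem : ∀ x, x ∈ (Subgroup.centralizer (φ '' S)).comap φ ↔
        ∀ s ∈ S, φ s * φ x = φ x * φ s := by
      intro x
      rw [Subgroup.mem_comap, Subgroup.mem_centralizer_iff]
      exact Set.forall_mem_image
    let N : Subgroup G := Subgroup.closure S ⊓ (Subgroup.centralizer (φ '' S)).comap φ
    have hSc : ∀ x, ∀ s ∈ S, x * s * x⁻¹ ∈ S := fun x s hs => lt_of_le_of_lt (hconj x s) hs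
    have hcn : (Subgroup.closure S).Normal := by
      have : Subgroup.closure S = Subgroup.normalClosure S := by
        rw [Subgroup.normalClosure]
        congr 1
        ext y
        rw [Group.mem_conjugatesOfSet_iff]
        constructor
        · intro hy; exact ⟨y, hy, IsConj.refl y⟩
        · rintro ⟨a, ha, hc⟩
          obtain ⟨c, rfl⟩ := isConj_iff.1 hc
          exact hSc _ _ ha
      rw [this]; infer_instance
    have hNn : N.Normal := by
      refine ⟨fun n hn x => ⟨hcn.conj_mem n hn.1 x, ?_⟩⟩
      have h2 := hn.2
      refine (hNmem _).2 fun s hs => ?_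
      replace h2 := (hNmem _).1 h2
      have := h2 _ (by simpa using hSc x⁻¹ s hs : x⁻¹ * s * x ∈ S)
      simp only [map_mul, map_inv] at this ⊢
      have h3 := congrArg (fun y => φ x * y * (φ x)⁻¹) this
      simpa [mul_assoc] using h3
    have hNk : ⁅N, N⁆ ≤ ρ.ker := by
      rw [Subgroup.commutator_le]
      intro x hx y hy
      have hx2 := hx.2
      have hy1 := hy.1
      have : φ y ∈ Subgroup.closure (φ '' S) := by
        rw [← MonoidHom.map_closure]; exact ⟨y, hy1, rfl⟩
      have hc : Subgroup.closure (φ '' S) ≤ Subgroup.centralizer {φ x} := by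
        rw [Subgroup.closure_le]
        rintro _ ⟨s, hs, rfl⟩
        rw [SetLike.mem_coe, Subgroup.mem_centralizer_singleton_iff]
        exact (hNmem _).1 hx2 s hs
      have h3 := Subgroup.mem_centralizer_singleton_iff.1 (hc this)
      change ρ _ = 1
      rw [← hφk, map_commutatorElement, commutatorElement_eq_one_iff_mul_comm, h3]
    rw [hG.2 N hNn] at hNk
    refine hgk (hNk ⟨Subgroup.subset_closure hgS, ?_⟩)
    refine (hNmem _).2 fun s hs => ?_
    have := hgc s hs
    rw [← hφk, map_commutatorElement, commutatorElement_eq_one_iff_mul_comm] at this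
    exact this.symm
  have hsep : ∀ g h, ρ g ≠ ρ h → 1/2 ≤ ‖ρ g - ρ h‖ := by
    intro g h hne
    by_contra! hlt
    have h1 : ρ (g * h⁻¹) - 1 = (ρ g - ρ h) * ρ h⁻¹ := by
      rw [sub_mul, hinv, hmul]
    have : g * h⁻¹ ∈ ρ.ker := hSker _ (by
      change ‖_‖ < _
      rw [h1]; exact (hle' _ _).trans_lt hlt)
    apply hne
    have h2 : ρ (g * h⁻¹) = 1 := this
    calc ρ g = ρ (g * h⁻¹ * h) := by simp
      _ = ρ h := by rw [hmul, h2, one_mul]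
  have hfin : (Set.range (fun g => (2:ℝ) • ρ g)).Finite := Set.finite_range _
  have hb := Besicovitch.card_le_of_separated hfin.toFinset (by
      intro c hc
      obtain ⟨g, rfl⟩ := hfin.mem_toFinset.1 hc
      rw [norm_smul]; have := hρ g; norm_num; exact this) (by
      intro c hc c' hc' hne
      obtain ⟨g, rfl⟩ := hfin.mem_toFinset.1 hc
      obtain ⟨h, rfl⟩ := hfin.mem_toFinset.1 hc'
      have := hsep g h (fun e => hne (by simp [e]))
      simp only
      rw [← smul_sub, norm_smul]; norm_num; linarith)
  refine le_trans ?_ hb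
  rw [← Set.ncard_eq_toFinset_card _ hfin, Subgroup.index]
  change _ ≤ Nat.card (Set.range _)
  have : Finite (Set.range (fun g => (2:ℝ) • ρ g)) := hfin
  refine Nat.card_le_card_of_injective (Quotient.lift (fun g => ⟨(2:ℝ) • ρ g, g, rfl⟩) ?_) ?_
  · intro a b hab
    have h0 : a⁻¹ * b ∈ ρ.ker := QuotientGroup.leftRel_apply.1 hab
    have h2 : ρ (a⁻¹ * b) = 1 := h0
    have : ρ a = ρ b := by
      calc ρ a = ρ a * ρ (a⁻¹ * b) := by rw [h2, mul_one]
        _ = ρ b := by rw [← hmul]; simp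
    simp [this]
  · intro a b
    induction a using Quotient.inductionOn with | _ a
    induction b using Quotient.inductionOn with | _ b
    intro hab
    have h1 := congrArg Subtype.val hab
    simp only [Quotient.lift_mk] at h1
    have h2 : ρ a = ρ b := smul_right_injective R (two_ne_zero (α := ℝ)) h1
    apply Quotient.sound
    apply QuotientGroup.leftRel_apply.2
    change ρ _ = 1
    rw [hmul, ← h2, hinv']

theorem spectral_aux {E ι : Type*} [NormedAddCommGroup E] [InnerProductSpace ℝ E]
    [FiniteDimensional ℝ E] [Fintype ι] (e : OrthonormalBasis ι ℝ E) (T : E →ₗ[ℝ] E)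
    (hT : T.IsSymmetric) (τ B : ℝ) (hτ : 0 < τ) (hB : ∑ x, ‖T (e x)‖ ^ 2 ≤ B) :
    ∃ V : Submodule ℝ E, Module.finrank ℝ V * τ ^ 2 ≤ B ∧
      (∀ U : E →ₗ[ℝ] E, (∀ v, U (T v) = T (U v)) → ∀ v ∈ V, U v ∈ V) ∧
      ∀ f, ∃ v ∈ V, ‖T f - v‖ ≤ τ * ‖f‖ := by
  classical
  set b := hT.eigenvectorBasis rfl with hb
  set l := hT.eigenvalues rfl with hl
  have hbl : ∀ i, T (b i) = l i • b i := fun i => hT.apply_eigenvectorBasis rfl i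
  let I := Finset.univ.filter (fun i => τ ≤ |l i|)
  let V : Submodule ℝ E := Submodule.span ℝ (I.image b : Finset E)
  have hVe : ∀ i ∈ I, b i ∈ V := fun i hi =>
    Submodule.subset_span (by simpa using ⟨i, hi, rfl⟩)
  have hTb : ∀ i v, inner ℝ (b i) (T v) = l i * inner ℝ (b i) v := fun i v => by
    rw [← hT, hbl, inner_smul_left]; rfl
  refine ⟨V, ?_, ?_, ?_⟩
  · have h1 : Module.finrank ℝ V ≤ I.card := (finrank_span_finset_le_card _).trans
      Finset.card_image_le
    have h2 : ∑ i, (l i) ^ 2 = ∑ x, ‖T (e x)‖ ^ 2 := by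
      calc ∑ i, (l i) ^ 2 = ∑ i, ‖T (b i)‖ ^ 2 := by
            refine Finset.sum_congr rfl fun i _ => ?_
            rw [hbl, norm_smul]; simp
        _ = ∑ i, ∑ x, (inner ℝ (e x) (T (b i))) ^ 2 := by
            refine Finset.sum_congr rfl fun i _ => ?_
            rw [← e.sum_sq_norm_inner_right]; simp
        _ = ∑ x, ∑ i, (inner ℝ (b i) (T (e x))) ^ 2 := by
            rw [Finset.sum_comm]
            refine Finset.sum_congr rfl fun x _ => Finset.sum_congr rfl fun i _ => ?_
            rw [← hT, real_inner_comm]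
        _ = _ := by
            refine Finset.sum_congr rfl fun i _ => ?_
            rw [← b.sum_sq_norm_inner_right]; simp
    calc (Module.finrank ℝ V : ℝ) * τ ^ 2 ≤ I.card * τ ^ 2 := by gcongr
      _ = ∑ i ∈ I, τ ^ 2 := by simp
      _ ≤ ∑ i ∈ I, (l i) ^ 2 := by
          refine Finset.sum_le_sum fun i hi => ?_
          have : τ ≤ |l i| := (Finset.mem_filter.1 hi).2
          rw [← sq_abs (l i)]; gcongr
      _ ≤ ∑ i, (l i) ^ 2 := Finset.sum_le_sum_of_subset_of_nonneg (Finset.subset_univ _)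
          (fun _ _ _ => sq_nonneg _)
      _ ≤ B := h2 ▸ hB
  · intro U hU v hv
    have : V ≤ V.comap U := by
      refine Submodule.span_le.2 ?_
      intro w hw
      simp only [Finset.coe_image, Set.mem_image, Finset.mem_coe] at hw
      obtain ⟨i, hi, rfl⟩ := hw
      change U (b i) ∈ V
      rw [← b.sum_repr' (U (b i))]
      refine Submodule.sum_mem _ fun j _ => ?_
      have h1 : l j * inner ℝ (b j) (U (b i)) = l i * inner ℝ (b j) (U (b i)) := by
        rw [← hTb, ← hU, hbl, map_smul, inner_smul_right]
      by_cases h0 : inner ℝ (b j) (U (b i)) = 0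
      · rw [h0, zero_smul]; exact V.zero_mem
      · have := mul_right_cancel₀ h0 h1
        refine V.smul_mem _ (hVe j ?_)
        simp only [I, Finset.mem_filter, Finset.mem_univ, true_and] at hi ⊢
        rwa [this]
    exact this hv
  · intro f
    refine ⟨∑ i ∈ I, inner ℝ (b i) (T f) • b i,
      Submodule.sum_mem _ fun i hi => V.smul_mem _ (hVe i hi), ?_⟩
    have hin : ∀ j, inner ℝ (b j) (T f - ∑ i ∈ I, inner ℝ (b i) (T f) • b i)
        = if j ∈ I then 0 else l j * inner ℝ (b j) f := by
      intro j
      rw [inner_sub_right, inner_sum]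
      simp only [inner_smul_right, OrthonormalBasis.inner_eq_ite]
      simp only [mul_ite, mul_one, mul_zero, Finset.sum_ite_eq]
      split_ifs <;> simp [hTb]
    refine le_of_sq_le_sq ?_ (by positivity)
    rw [mul_pow, ← b.sum_sq_norm_inner_right, ← b.sum_sq_norm_inner_right f, Finset.mul_sum]
    refine Finset.sum_le_sum fun j _ => ?_
    rw [hin]
    split_ifs with hj
    · simp; positivity
    · have : |l j| < τ := by simpa [I] using hj
      rw [norm_mul, mul_pow]
      gcongr
      exact this.le

theorem packing_aux (d : ℕ) (δ : ℝ) (hδ : 0 < δ) (hδ1 : δ < 1) :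
    ∃ M : ℕ, ∀ (G : Type) [Fintype G] [DecidableEq G] (F : Finset (Finset G)),
      (∀ s ∈ F, ∀ t ∈ F, s ≠ t → δ * Fintype.card G < ((symmDiff s t).card : ℝ)) →
      (∀ X, F.Shatters X → X.card ≤ d) → F.card ≤ M := by
  obtain ⟨m, hm⟩ : ∃ m : ℕ, (((d + 1) * (m + 1) ^ d + 1 : ℕ) : ℝ) ^ 2 * (1 - δ) ^ m < 1 := by
    have ht := (tendsto_pow_const_mul_const_pow_of_abs_lt_one (2 * d)
      (r := 1 - δ) (by rw [abs_lt]; constructor <;> linarith)).const_mul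
        (((d : ℝ) + 2) ^ 2 * 2 ^ (2 * d))
    rw [mul_zero] at ht
    obtain ⟨m, h1, hm1⟩ := ((ht.eventually (gt_mem_nhds zero_lt_one)).and
      (Filter.eventually_ge_atTop 1)).exists
    refine ⟨m, lt_of_le_of_lt ?_ h1⟩
    have h0 : 0 ≤ (1 - δ) ^ m := pow_nonneg (by linarith) _
    have hm1' : (1 : ℝ) ≤ m := by exact_mod_cast hm1
    have h2 : (((d + 1) * (m + 1) ^ d + 1 : ℕ) : ℝ) ≤ (d + 2) * (2 * m) ^ d := by
      push_cast
      have h3 : (m + 1 : ℝ) ^ d ≤ (2 * m) ^ d := by gcongr; linarith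
      have h4 : (1 : ℝ) ≤ (2 * m) ^ d := one_le_pow₀ (by linarith)
      have h5 : ((d : ℝ) + 1) * (m + 1 : ℝ) ^ d ≤ (d + 1) * (2 * m) ^ d := by gcongr
      linarith
    calc _ ≤ ((d + 2) * (2 * m : ℝ) ^ d) ^ 2 * (1 - δ) ^ m := by gcongr
      _ = _ := by rw [mul_pow, mul_pow, mul_pow, ← pow_mul, ← pow_mul, mul_comm d 2]; ring
  refine ⟨(d + 1) * (m + 1) ^ d, fun G _ _ F hF hvc => ?_⟩
  by_contra! hcard
  set M := (d + 1) * (m + 1) ^ d with hM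
  obtain ⟨F', hF'F, hF'c⟩ := Finset.exists_subset_card_eq (show M + 1 ≤ F.card from hcard)
  have hFG : 0 < Fintype.card G := by
    rw [Fintype.card_pos_iff]
    by_contra hne
    rw [not_nonempty_iff] at hne
    have h2 : F.card ≤ 1 := Finset.card_le_one_of_subsingleton _
    have h3 : 0 < (m + 1) ^ d := by positivity
    have h4 : 1 ≤ (d + 1) * (m + 1) ^ d := Nat.mul_pos (by omega) h3
    omega
  have hFGr : (0 : ℝ) < Fintype.card G := by exact_mod_cast hFG
  -- good sample
  obtain ⟨p, hp⟩ : ∃ p : Fin m → G, ∀ q ∈ F'.offDiag, ∃ i, p i ∈ symmDiff q.1 q.2 := by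
    by_contra! hno
    have hsub : (Finset.univ : Finset (Fin m → G)) ⊆ F'.offDiag.biUnion
        (fun q => Fintype.piFinset (fun _ : Fin m => (symmDiff q.1 q.2)ᶜ)) := by
      intro p _
      obtain ⟨q, hq, hq'⟩ := hno p
      rw [Finset.mem_biUnion]
      exact ⟨q, hq, by rw [Fintype.mem_piFinset]; exact fun i => Finset.mem_compl.2 (hq' i)⟩
    have h1 := (Finset.card_le_card hsub).trans Finset.card_biUnion_le
    have h2 : ((Fintype.card G : ℝ)) ^ m ≤
        ∑ q ∈ F'.offDiag, ((1 - δ) * Fintype.card G) ^ m := by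
      have h3 : ((Fintype.card G : ℝ)) ^ m ≤ ∑ q ∈ F'.offDiag,
          (((symmDiff q.1 q.2)ᶜ.card : ℕ) : ℝ) ^ m := by
        simp only [Finset.card_univ, Fintype.card_fun, Fintype.card_fin,
          Fintype.card_piFinset_const] at h1
        exact_mod_cast h1
      refine h3.trans (Finset.sum_le_sum fun q hq => ?_)
      rw [Finset.mem_offDiag] at hq
      have h4 := hF _ (hF'F hq.1) _ (hF'F hq.2.1) hq.2.2
      have h5 : (((symmDiff q.1 q.2)ᶜ.card : ℕ) : ℝ) = Fintype.card G - (symmDiff q.1 q.2).card := by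
        rw [Finset.card_compl, Nat.cast_sub (Finset.card_le_univ _)]
      gcongr
      rw [h5]; linarith
    rw [Finset.sum_const, nsmul_eq_mul, mul_pow] at h2
    have h6 : (F'.offDiag.card : ℝ) ≤ ((M + 1 : ℕ) : ℝ) ^ 2 := by
      have : F'.offDiag.card ≤ (M + 1) ^ 2 := by
        rw [Finset.offDiag_card, hF'c, sq]; omega
      exact_mod_cast this
    have h0 : 0 ≤ (1 - δ) ^ m := pow_nonneg (by linarith) _
    have hp : 0 < (Fintype.card G : ℝ) ^ m := by positivity
    have h7 : (F'.offDiag.card : ℝ) * (1 - δ) ^ m < 1 :=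
      lt_of_le_of_lt (mul_le_mul_of_nonneg_right h6 h0) hm
    nlinarith
  set Y := Finset.univ.image p with hY
  have hYc : Y.card ≤ m := Finset.card_image_le.trans (by simp)
  have hinj : Set.InjOn (fun s => Y ∩ s) (F' : Set (Finset G)) := by
    intro s hs t ht hst
    by_contra hne
    obtain ⟨i, hi⟩ := hp (s, t) (Finset.mem_offDiag.2 ⟨hs, ht, hne⟩)
    have hiY : p i ∈ Y := Finset.mem_image_of_mem _ (Finset.mem_univ _)
    have h1 := Finset.ext_iff.1 hst (p i)
    simp only [Finset.mem_inter, hiY, true_and] at h1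
    rw [Finset.mem_symmDiff] at hi
    tauto
  have h1 : (F'.image (fun s => Y ∩ s)).card = M + 1 := by
    rw [Finset.card_image_of_injOn hinj, hF'c]
  have h2 := Finset.card_le_card_shatterer (F'.image (fun s => Y ∩ s))
  have h3 : (F'.image (fun s => Y ∩ s)).shatterer ⊆
      (Finset.range (d + 1)).biUnion (fun k => Y.powersetCard k) := by
    intro X hX
    rw [Finset.mem_shatterer] at hX
    have hXY : X ⊆ Y := by
      obtain ⟨t, ht, hXt⟩ := hX.exists_superset
      obtain ⟨s, _, rfl⟩ := Finset.mem_image.1 ht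
      exact hXt.trans Finset.inter_subset_left
    have hXd : X.card ≤ d := by
      refine hvc X fun t ht => ?_
      obtain ⟨u, hu, hut⟩ := hX ht
      obtain ⟨s, hs, rfl⟩ := Finset.mem_image.1 hu
      refine ⟨s, hF'F hs, ?_⟩
      rw [← hut, ← Finset.inter_assoc, Finset.inter_eq_left.2 hXY]
    simp only [Finset.mem_biUnion, Finset.mem_range, Finset.mem_powersetCard]
    exact ⟨X.card, by omega, hXY, rfl⟩
  have h4 := (Finset.card_le_card h3).trans Finset.card_biUnion_le
  have h5 : ∑ k ∈ Finset.range (d + 1), (Y.powersetCard k).card ≤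
      ∑ k ∈ Finset.range (d + 1), (m + 1) ^ d := by
    refine Finset.sum_le_sum fun k hk => ?_
    rw [Finset.card_powersetCard]
    calc Y.card.choose k ≤ Y.card ^ k := Nat.choose_le_pow _ _
      _ ≤ (m + 1) ^ k := Nat.pow_le_pow_left (by omega) _
      _ ≤ (m + 1) ^ d := Nat.pow_le_pow_right (by omega) (by simpa [Nat.lt_succ_iff] using hk)
  simp only [Finset.sum_const, Finset.card_range, smul_eq_mul] at h5
  omega

theorem cover_aux (d : ℕ) (δ : ℝ) (hδ : 0 < δ) (hδ1 : δ < 1) :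
    ∃ M : ℕ, ∀ (G : Type) [Group G] [Fintype G] [DecidableEq G] (A : Finset G),
      VCDimLE (A : Set G) d →
      Fintype.card G ≤ M * (Finset.univ.filter
        (fun g : G => ((symmDiff (g • A) A).card : ℝ) ≤ δ * Fintype.card G)).card := by
  obtain ⟨M, hM⟩ := packing_aux d δ hδ hδ1
  refine ⟨M, fun G _ _ _ A hA => ?_⟩
  set S := (Finset.univ.filter
        (fun g : G => ((symmDiff (g • A) A).card : ℝ) ≤ δ * Fintype.card G)) with hS
  let P : Finset G → Prop := fun Γ => ∀ g ∈ Γ, ∀ h ∈ Γ, g ≠ h →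
    δ * Fintype.card G < ((symmDiff (g • A) (h • A)).card : ℝ)
  obtain ⟨Γ, hΓ⟩ := (Set.toFinite {Γ | P Γ}).exists_maximal ⟨∅, by simp [P]⟩
  have hΓP : P Γ := hΓ.prop
  have hpos : 0 ≤ δ * Fintype.card G := by positivity
  have hinj : Set.InjOn (fun g : G => g • A) (Γ : Set G) := by
    intro g hg h hh hgh
    by_contra hne
    have := hΓP g hg h hh hne
    simp only at hgh
    rw [hgh] at this
    simp at this
    linarith
  have hΓM : Γ.card ≤ M := by
    rw [← Finset.card_image_of_injOn hinj]
    apply hM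
    · intro s hs t ht hst
      obtain ⟨g, hg, rfl⟩ := Finset.mem_image.1 hs
      obtain ⟨h, hh, rfl⟩ := Finset.mem_image.1 ht
      exact hΓP g hg h hh (fun e => hst (by rw [e]))
    · intro X hX
      apply hA
      intro T hT
      obtain ⟨u, hu, hut⟩ := hX hT
      obtain ⟨g, hg, rfl⟩ := Finset.mem_image.1 hu
      refine ⟨g, ?_⟩
      rw [← hut]; push_cast; rfl
  have hsym : ∀ g h : G, (symmDiff (g • A) (h • A)).card = (symmDiff ((h⁻¹ * g) • A) A).card := by
    intro g h
    rw [← Finset.card_smul_finset h⁻¹ (symmDiff (g • A) (h • A)), Finset.smul_finset_symmDiff,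
      smul_smul, smul_smul, inv_mul_cancel, one_smul]
  have hcov : (Finset.univ : Finset G) ⊆ Γ * S := by
    intro g _
    rw [Finset.mem_mul]
    by_contra! hno
    have hno' : ∀ γ ∈ Γ, δ * Fintype.card G < ((symmDiff (g • A) (γ • A)).card : ℝ) := by
      intro γ hγ
      by_contra! hle
      refine hno γ hγ (γ⁻¹ * g) ?_ (by simp)
      rw [hsym] at hle
      simpa [hS] using hle
    have hgΓ : g ∉ Γ := by
      intro hg
      have := hno' g hg
      simp at this
      linarith
    have hP : P (insert g Γ) := by
      intro a ha b hb hab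
      rw [Finset.mem_insert] at ha hb
      rcases ha with rfl | ha <;> rcases hb with rfl | hb
      · exact absurd rfl hab
      · exact hno' _ hb
      · rw [symmDiff_comm]; exact hno' _ ha
      · exact hΓP a ha b hb hab
    exact hgΓ (hΓ.le_of_ge hP (Finset.subset_insert _ _) (Finset.mem_insert_self _ _))
  calc Fintype.card G = (Finset.univ : Finset G).card := rfl
    _ ≤ (Γ * S).card := Finset.card_le_card hcov
    _ ≤ Γ.card * S.card := Finset.card_mul_le
    _ ≤ M * S.card := Nat.mul_le_mul_right _ hΓM

noncomputable def rOp {G : Type} [Group G] (g : G) :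
    EuclideanSpace ℝ G →ₗ[ℝ] EuclideanSpace ℝ G where
  toFun f := WithLp.toLp 2 (fun x => f (x * g))
  map_add' f h := by ext x; simp
  map_smul' c f := by ext x; simp

noncomputable def lOp {G : Type} [Group G] (g : G) :
    EuclideanSpace ℝ G →ₗ[ℝ] EuclideanSpace ℝ G where
  toFun f := WithLp.toLp 2 (fun x => f (g⁻¹ * x))
  map_add' f h := by ext x; simp
  map_smul' c f := by ext x; simp

theorem rOp_apply {G : Type} [Group G] (g x : G) (f : EuclideanSpace ℝ G) :
    rOp g f x = f (x * g) := rfl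

theorem lOp_apply {G : Type} [Group G] (g x : G) (f : EuclideanSpace ℝ G) :
    lOp g f x = f (g⁻¹ * x) := rfl

theorem norm_rOp {G : Type} [Group G] [Fintype G] (g : G) (f : EuclideanSpace ℝ G) :
    ‖rOp g f‖ = ‖f‖ := by
  rw [EuclideanSpace.norm_eq, EuclideanSpace.norm_eq]
  congr 1
  exact Fintype.sum_equiv (Equiv.mulRight g) _ _ (fun x => rfl)

noncomputable def avgOp {G : Type} [Group G] (S : Finset G) :
    EuclideanSpace ℝ G →ₗ[ℝ] EuclideanSpace ℝ G :=
  (S.card : ℝ)⁻¹ • ∑ s ∈ S, lOp s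

theorem avgOp_eq {G : Type} [Group G] (S : Finset G) (f : EuclideanSpace ℝ G) :
    avgOp S f = (S.card : ℝ)⁻¹ • ∑ s ∈ S, lOp s f := by
  simp [avgOp, LinearMap.sum_apply]

theorem avgOp_symm {G : Type} [Group G] [Fintype G] (S : Finset G)
    (hS : ∀ s ∈ S, s⁻¹ ∈ S) : (avgOp S).IsSymmetric := by
  intro f h
  rw [avgOp_eq, avgOp_eq, inner_smul_left, inner_smul_right, sum_inner, inner_sum]
  simp only [conj_trivial]
  congr 1
  refine Finset.sum_bij' (fun s _ => s⁻¹) (fun s _ => s⁻¹) hS hS (by simp) (by simp) ?_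
  intro s _
  rw [PiLp.inner_apply, PiLp.inner_apply]
  refine Fintype.sum_equiv (Equiv.mulLeft s⁻¹) _ _ (fun x => ?_)
  simp [lOp_apply]

theorem avgOp_basis {G : Type} [Group G] [Fintype G] [DecidableEq G] (S : Finset G)
    (hS : S.Nonempty) (y : G) :
    ‖avgOp S (EuclideanSpace.basisFun G ℝ y)‖ ^ 2 = (S.card : ℝ)⁻¹ := by
  have hval : ∀ z, avgOp S (EuclideanSpace.basisFun G ℝ y) z =
      (S.card : ℝ)⁻¹ * if z * y⁻¹ ∈ S then 1 else 0 := by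
    intro z
    rw [avgOp_eq]
    have h1 : (∑ s ∈ S, lOp s (EuclideanSpace.basisFun G ℝ y)) z =
        ∑ s ∈ S, if z * y⁻¹ = s then (1 : ℝ) else 0 := by
      rw [WithLp.ofLp_sum, Finset.sum_apply]
      refine Finset.sum_congr rfl fun s _ => ?_
      rw [lOp_apply, EuclideanSpace.basisFun_apply, PiLp.single_apply]
      congr 1
      rw [inv_mul_eq_iff_eq_mul, mul_inv_eq_iff_eq_mul]
    rw [PiLp.smul_apply, h1, smul_eq_mul, Finset.sum_ite_eq]
  rw [EuclideanSpace.norm_sq_eq]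
  simp only [hval]
  have h2 : ∀ z, ‖(S.card : ℝ)⁻¹ * (if z * y⁻¹ ∈ S then (1:ℝ) else 0)‖ ^ 2 =
      ((S.card : ℝ)⁻¹) ^ 2 * (if z * y⁻¹ ∈ S then (1:ℝ) else 0) := by
    intro z; split_ifs <;> simp
  simp only [h2]
  rw [← Finset.mul_sum]
  have h3 : ∑ z, (if z * y⁻¹ ∈ S then (1:ℝ) else 0) = S.card := by
    refine (Fintype.sum_equiv (Equiv.mulRight y⁻¹) _ (fun z => if z ∈ S then (1:ℝ) else 0)
      (fun x => rfl)).trans ?_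
    simp
  rw [h3]
  have : (S.card : ℝ) ≠ 0 := by exact_mod_cast hS.card_pos.ne'
  field_simp

theorem rep_aux {G W : Type} [Group G] [Finite G] [NormedAddCommGroup W] [NormedSpace ℝ W]
    [FiniteDimensional ℝ W] (hG : PurelyNonabelian G) (n : ℕ) (hn : Module.finrank ℝ W ≤ n)
    (r : G → W →ₗ[ℝ] W) (h1 : ∀ v, r 1 v = v) (hmul : ∀ g h v, r (g * h) v = r g (r h v))
    (hnorm : ∀ g v, ‖r g v‖ ≤ ‖v‖) :
    ∃ H : Subgroup G, H.Normal ∧ H.index ≤ 5 ^ (n * n) ∧ ∀ h ∈ H, ∀ v, r h v = v := by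
  let ρ : G →* (W →L[ℝ] W) :=
    { toFun := fun g => LinearMap.toContinuousLinearMap (r g)
      map_one' := by
        ext v
        exact h1 v
      map_mul' := by
        intro g h
        ext v
        exact hmul g h v }
  have hρ : ∀ g v, ρ g v = r g v := fun g v => rfl
  have hρn : ∀ g, ‖ρ g‖ ≤ 1 := by
    intro g
    refine ContinuousLinearMap.opNorm_le_bound _ zero_le_one fun v => ?_
    rw [one_mul, hρ]
    exact hnorm g v
  have hfr : Module.finrank ℝ (W →L[ℝ] W) = Module.finrank ℝ W * Module.finrank ℝ W := by
    rw [← (LinearMap.toContinuousLinearMap (𝕜 := ℝ) (E := W) (F' := W)).finrank_eq,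
      Module.finrank_linearMap]
  have hidx := jordan_aux (R := W →L[ℝ] W) hG ρ hρn
  rw [hfr] at hidx
  refine ⟨ρ.ker, inferInstance, hidx.trans (Nat.pow_le_pow_right (by norm_num)
    (Nat.mul_le_mul hn hn)), ?_⟩
  intro h hh v
  have h2 : ρ h = 1 := hh
  rw [← hρ, h2]; rfl

theorem core_aux (d : ℕ) (η : ℝ) (hη : 0 < η) :
    ∃ C : ℕ, ∀ (G : Type) [Group G] [Fintype G] [DecidableEq G],
      PurelyNonabelian G →
      ∀ A : Finset G, VCDimLE (A : Set G) d →
      ∃ H : Subgroup G, H.Normal ∧ H.index ≤ C ∧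
        ∃ D : Finset G, (∀ x, ∀ h ∈ H, (x * h ∈ D ↔ x ∈ D)) ∧
          ((symmDiff A D).card : ℝ) ≤ η * (Fintype.card G : ℝ) := by
  set τ : ℝ := min (Real.sqrt η / 4) (1/2) with hτdef
  have hτ : 0 < τ := by have := Real.sqrt_pos.2 hη; positivity
  have hτ2 : τ ≤ 1/2 := min_le_right _ _
  have hτ1 : 16 * τ ^ 2 ≤ η := by
    have h1 : τ ≤ Real.sqrt η / 4 := min_le_left _ _
    have h2 := Real.sq_sqrt hη.le
    nlinarith
  obtain ⟨M, hM⟩ := cover_aux d (τ ^ 2) (by positivity) (by nlinarith)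
  set n := ⌊(M : ℝ) / τ ^ 2⌋₊ with hn
  refine ⟨5 ^ (n * n), fun G _ _ _ hG A hA => ?_⟩
  set S := (Finset.univ.filter
        (fun g : G => ((symmDiff (g • A) A).card : ℝ) ≤ τ ^ 2 * Fintype.card G)) with hS
  have hMG : Fintype.card G ≤ M * S.card := hM G A hA
  have hSne : S.Nonempty := ⟨1, by simp [hS]; positivity⟩
  have hSpos : (0 : ℝ) < S.card := by exact_mod_cast hSne.card_pos
  have hSinv : ∀ s ∈ S, s⁻¹ ∈ S := by
    intro s hs
    simp only [hS, Finset.mem_filter, Finset.mem_univ, true_and] at hs ⊢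
    rwa [← Finset.card_smul_finset s, Finset.smul_finset_symmDiff, smul_smul, mul_inv_cancel,
      one_smul, symmDiff_comm]
  obtain ⟨V, hVdim, hVinv, hVapp⟩ := spectral_aux (EuclideanSpace.basisFun G ℝ) (avgOp S)
    (avgOp_symm S hSinv) τ M hτ (by
      simp only [avgOp_basis S hSne, Finset.sum_const, Finset.card_univ, nsmul_eq_mul]
      rw [← div_eq_mul_inv, div_le_iff₀ hSpos]
      exact_mod_cast hMG)
  have hVn : Module.finrank ℝ V ≤ n := by
    rw [hn]; apply Nat.le_floor
    rwa [le_div_iff₀ (by positivity)]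
  have hVr : ∀ g, ∀ v ∈ V, rOp g v ∈ V := by
    intro g
    apply hVinv
    intro v
    rw [avgOp_eq, avgOp_eq, map_smul, map_sum]
    congr 1
    refine Finset.sum_congr rfl fun s _ => ?_
    ext x
    simp [rOp_apply, lOp_apply, mul_assoc]
  obtain ⟨H, hHn, hHi, hH⟩ := rep_aux hG n hVn (fun g => (rOp g).restrict (hVr g))
    (fun v => by ext x; simp [rOp_apply])
    (fun g h v => by ext x; simp [rOp_apply, mul_assoc])
    (fun g v => (norm_rOp g (v : EuclideanSpace ℝ G)).le)
  refine ⟨H, hHn, hHi, ?_⟩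
  -- the indicator function
  let f : EuclideanSpace ℝ G := WithLp.toLp 2 (fun x => if x ∈ A then 1 else 0)
  have hf : ∀ x, f x = if x ∈ A then 1 else 0 := fun x => rfl
  obtain ⟨v, hvV, hv⟩ := hVapp f
  have hvH : ∀ x, ∀ h ∈ H, v (x * h) = v x := by
    intro x h hh
    have h3 : rOp h v = v := congrArg Subtype.val (hH h hh ⟨v, hvV⟩)
    conv_rhs => rw [← h3]
    rfl
  set q := Real.sqrt (Fintype.card G) with hq
  have hq2 : q ^ 2 = Fintype.card G := Real.sq_sqrt (by positivity)
  have hq0 : 0 ≤ q := Real.sqrt_nonneg _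
  have hfn : ‖f‖ ≤ q := by
    refine le_of_sq_le_sq ?_ hq0
    rw [hq2, EuclideanSpace.norm_sq_eq]
    calc ∑ x, ‖f x‖ ^ 2 ≤ ∑ x : G, (1 : ℝ) := by
          refine Finset.sum_le_sum fun x _ => ?_
          rw [hf]; split_ifs <;> simp
      _ = _ := by simp
  have hls : ∀ s ∈ S, ‖lOp s f - f‖ ≤ τ * q := by
    intro s hs
    refine le_of_sq_le_sq ?_ (by positivity)
    rw [mul_pow, hq2, EuclideanSpace.norm_sq_eq]
    have h1 : ∀ x, ‖(lOp s f - f) x‖ ^ 2 = if x ∈ symmDiff (s • A) A then (1 : ℝ) else 0 := by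
      intro x
      rw [PiLp.sub_apply, lOp_apply, hf, hf]
      have h4 : x ∈ s • A ↔ s⁻¹ * x ∈ A := by
        rw [← Finset.inv_smul_mem_iff, smul_eq_mul]
      simp only [Finset.mem_symmDiff, h4]
      by_cases h2 : s⁻¹ * x ∈ A <;> by_cases h3 : x ∈ A <;> simp [h2, h3]
    simp only [h1]
    simp only [hS, Finset.mem_filter, Finset.mem_univ, true_and] at hs
    simpa using hs
  have hTf : ‖avgOp S f - f‖ ≤ τ * q := by
    have h1 : avgOp S f - f = (S.card : ℝ)⁻¹ • ∑ s ∈ S, (lOp s f - f) := by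
      rw [avgOp_eq, Finset.sum_sub_distrib, smul_sub, Finset.sum_const, ← Nat.cast_smul_eq_nsmul ℝ,
        smul_smul, inv_mul_cancel₀ hSpos.ne', one_smul]
    rw [h1, norm_smul, norm_inv, Real.norm_of_nonneg hSpos.le, inv_mul_le_iff₀ hSpos]
    refine (norm_sum_le _ _).trans ((Finset.sum_le_sum hls).trans ?_)
    simp
  have hfv : ‖f - v‖ ≤ 2 * τ * q := by
    have h1 : f - v = (avgOp S f - v) - (avgOp S f - f) := by abel
    rw [h1]
    refine (norm_sub_le _ _).trans ?_
    have : τ * ‖f‖ ≤ τ * q := by gcongr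
    linarith
  have hfv2 : ∑ x, ‖(f - v) x‖ ^ 2 ≤ 4 * τ ^ 2 * Fintype.card G := by
    rw [← EuclideanSpace.norm_sq_eq, ← hq2]
    calc ‖f - v‖ ^ 2 ≤ (2 * τ * q) ^ 2 := by gcongr
      _ = _ := by ring
  refine ⟨Finset.univ.filter (fun x => 1/2 ≤ v x), ?_, ?_⟩
  · intro x h hh
    simp [hvH x h hh]
  · set D := Finset.univ.filter (fun x => 1/2 ≤ v x) with hD
    have h1 : ((symmDiff A D).card : ℝ) * (1/4) ≤ ∑ x, ‖(f - v) x‖ ^ 2 := by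
      calc ((symmDiff A D).card : ℝ) * (1/4) = ∑ x ∈ symmDiff A D, (1/4 : ℝ) := by simp
        _ ≤ ∑ x ∈ symmDiff A D, ‖(f - v) x‖ ^ 2 := by
            refine Finset.sum_le_sum fun x hx => ?_
            rw [PiLp.sub_apply, hf, Real.norm_eq_abs, sq_abs]
            rw [Finset.mem_symmDiff] at hx
            simp only [hD, Finset.mem_filter, Finset.mem_univ, true_and, not_le] at hx
            rcases hx with ⟨ha, hb⟩ | ⟨ha, hb⟩
            · rw [if_pos ha]; nlinarith
            · rw [if_neg hb]; nlinarith
        _ ≤ _ := Finset.sum_le_sum_of_subset_of_nonneg (Finset.subset_univ _)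
            (fun _ _ _ => sq_nonneg _)
    have h2 : 16 * τ ^ 2 * (Fintype.card G : ℝ) ≤ η * Fintype.card G := by gcongr
    linarith

/-- **Regularity for bounded VC-dimension in purely nonabelian finite groups.**
For every positive integer `d` and real `ε > 0` there is `C` such that: if `G` is a
purely nonabelian finite group and `A ⊆ G` has VC-dimension at most `d`, then there is a
normal subgroup `H ≤ G` of index at most `C` such that (i) some union `D` of cosets of
`H` satisfies `|A △ D| ≤ ε|G|`, and (ii) some `Z ⊆ G` with `|Z| < ε^{1/2}|G|/2`
satisfies: for all `x ∉ Z`, either `|xH ∩ A| ≤ ε^{1/4}|H|` or `|xH \ A| ≤ ε^{1/4}|H|`. -/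
theorem vc_regularity_purely_nonabelian (d : ℕ) (hd : 0 < d) (ε : ℝ) (hε : 0 < ε) :
    ∃ C : ℕ, ∀ (G : Type) [Group G] [Fintype G] [DecidableEq G],
      PurelyNonabelian G →
      ∀ A : Finset G, VCDimLE (A : Set G) d →
      ∃ H : Subgroup G, H.Normal ∧ H.index ≤ C ∧
        (∃ D : Finset G, (∀ x ∈ D, ∀ h ∈ H, x * h ∈ D) ∧
          ((symmDiff A D).card : ℝ) ≤ ε * (Fintype.card G : ℝ)) ∧
        (∃ Z : Finset G, ((Z.card : ℝ) < (1 / 2) * ε ^ ((1 : ℝ) / 2) * (Fintype.card G : ℝ)) ∧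
          ∀ x : G, x ∉ Z →
            ((Nat.card ↥((x • (H : Set G)) ∩ (A : Set G)) : ℝ)
                ≤ ε ^ ((1 : ℝ) / 4) * (Nat.card H : ℝ)) ∨
            ((Nat.card ↥((x • (H : Set G)) \ (A : Set G)) : ℝ)
                ≤ ε ^ ((1 : ℝ) / 4) * (Nat.card H : ℝ))) := by
  classical
  set κ : ℝ := ε ^ ((1 : ℝ) / 4) with hκ
  set σ : ℝ := ε ^ ((1 : ℝ) / 2) with hσ
  have hκ0 : 0 < κ := Real.rpow_pos_of_pos hε _
  have hσ0 : 0 < σ := Real.rpow_pos_of_pos hε _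
  obtain ⟨C, hC⟩ := core_aux d (min ε (κ * σ / 4)) (by positivity)
  refine ⟨C, fun G _ _ _ hG A hA => ?_⟩
  obtain ⟨H, hHn, hHC, D, hD, hAD⟩ := hC G hG A hA
  have hGpos : (0 : ℝ) < Fintype.card G := by exact_mod_cast Fintype.card_pos
  refine ⟨H, hHn, hHC, ⟨D, fun x hx h hh => (hD x h hh).2 hx, hAD.trans ?_⟩, ?_⟩
  · gcongr; exact min_le_left _ _
  let W : Finset G := symmDiff A D
  let Hf : Finset G := Finset.univ.filter (· ∈ H)
  have hHf : (Nat.card H : ℝ) = Hf.card := by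
    rw [Nat.card_eq_fintype_card, Fintype.card_subtype]
  have hHpos : (0 : ℝ) < Hf.card := by
    rw [← hHf]; exact_mod_cast Nat.card_pos
  let c : G → ℕ := fun x => (Hf.filter (fun h => x * h ∈ W)).card
  have hkey : ∀ x (B : Set G), (∀ h ∈ H, x * h ∈ B → x * h ∈ W) →
      Nat.card ↥((x • (H : Set G)) ∩ B) ≤ c x := by
    intro x B hB
    change _ ≤ (Hf.filter (fun h => x * h ∈ W)).card
    rw [← Finset.card_image_of_injective _ (mul_right_injective x)]
    rw [← Set.ncard_coe_finset]
    refine Set.ncard_le_ncard ?_ (Set.toFinite _)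
    rintro y ⟨⟨h, hh, rfl⟩, hy⟩
    simp only [Finset.coe_image, Set.mem_image, Finset.mem_coe, Finset.mem_filter]
    exact ⟨h, ⟨by simpa [Hf] using hh, hB h hh hy⟩, rfl⟩
  refine ⟨Finset.univ.filter (fun x => κ * Hf.card < c x), ?_, ?_⟩
  · set Z := Finset.univ.filter (fun x => κ * Hf.card < c x) with hZ
    have h1 : ∑ x, c x = Hf.card * W.card := by
      simp only [c, Finset.card_filter]
      rw [Finset.sum_comm, ← smul_eq_mul, ← Finset.sum_const]
      refine Finset.sum_congr rfl fun h _ => ?_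
      refine (Fintype.sum_equiv (Equiv.mulRight h) _ (fun z => if z ∈ W then 1 else 0)
        (fun x => rfl)).trans ?_
      simp
    have h2 : (Z.card : ℝ) * (κ * Hf.card) ≤ Hf.card * W.card := by
      calc (Z.card : ℝ) * (κ * Hf.card) = ∑ x ∈ Z, κ * Hf.card := by simp
        _ ≤ ∑ x ∈ Z, (c x : ℝ) :=
            Finset.sum_le_sum fun x hx => (Finset.mem_filter.1 hx).2.le
        _ ≤ ∑ x, (c x : ℝ) := Finset.sum_le_sum_of_subset_of_nonneg (Finset.subset_univ _)
            (fun _ _ _ => by positivity)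
        _ = _ := by exact_mod_cast h1
    have h3 : (W.card : ℝ) ≤ κ * σ / 4 * Fintype.card G := hAD.trans (by
      gcongr; exact min_le_right _ _)
    have h4 : (Z.card : ℝ) * κ ≤ W.card := by
      refine le_of_mul_le_mul_right ?_ hHpos
      linarith
    have h5 : (Z.card : ℝ) ≤ σ / 4 * Fintype.card G := by
      refine le_of_mul_le_mul_right ?_ hκ0
      linarith
    have h6 : 0 < σ * Fintype.card G := by positivity
    linarith
  · intro x hx
    simp only [Finset.mem_filter, Finset.mem_univ, true_and, not_lt] at hx
    rw [hHf]
    by_cases hxD : x ∈ D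
    · right
      rw [Set.sdiff_eq]
      refine le_trans (Nat.cast_le.2 (hkey x _ ?_)) hx
      intro h hh hB
      exact Finset.mem_symmDiff.2 (Or.inr ⟨(hD x h hh).2 hxD, hB⟩)
    · left
      refine le_trans (Nat.cast_le.2 (hkey x _ ?_)) hx
      intro h hh hB
      exact Finset.mem_symmDiff.2 (Or.inl ⟨hB, fun h' => hxD ((hD x h hh).1 h')⟩)
end
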